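/- Fix a > 0, γ ∈ [1,2], ν > 0, constants 0 < ς̲₀ ≤ ς̄₀ and Ā > 0. There exist positive constants η̲, η̄, C and α, depending only on (a, γ, ν, ς̄₀, ς̲₀, Ā), with the following property: for every global smooth solution (η, w) of the 1D isentropic compressible Navier–Stokes system on [0,∞) × T whose initial data satisfy ς̲₀ ≤ η₀ ≤ ς̄₀, ∫_T η₀ dx = 1, ∫_T η₀ w₀ dx = 0 and ‖η₀ − 1‖²_{H⁴(T)} + ‖w₀‖²_{H⁴(T)} ≤ Ā, one has η̲ ≤ η(t,x) ≤ η̄ for all (t,x), and, setting A₅ := ‖η₀ − 1‖²_{H⁵(T)} + ‖w₀‖²_{H⁵(T)}, for all t ≥ 0: ‖(η − 1)(t,·)‖_{H⁴(T)} + ‖w(t,·)‖_{H⁵(T)} + Σ_{i=1}^{2} ( ‖∂_t^i η(t,·)‖_{H^{5−2i}(T)} + ‖∂_t^i w(t,·)‖_{H^{5−2i}(T)} ) ≤ C A₅^{1/2} e^{−α t}. -/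

import Mathlib

open MeasureTheory

/-- Square of the Sobolev `H^k` norm on the torus `𝕋 = ℝ/ℤ` of a `1`-periodic
function `f : ℝ → ℝ`: `‖f‖²_{H^k} = ∑_{0 ≤ j ≤ k} ∫_𝕋 (∂ₓ^j f)²`. -/
noncomputable def HSq (k : ℕ) (f : ℝ → ℝ) : ℝ :=
  ∑ j ∈ Finset.range (k + 1), ∫ x in (0:ℝ)..1, (deriv^[j] f x) ^ 2

namespace NSDecay

open scoped ContDiff

/-! ### Smooth periodic functions of one variable -/

/-- Smooth `1`-periodic functions on the line. -/
structure SmoothPer (f : ℝ → ℝ) : Prop where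
  smooth : ContDiff ℝ ∞ f
  per : ∀ x, f (x + 1) = f x

namespace SmoothPer

variable {f g : ℝ → ℝ}

lemma continuous (hf : SmoothPer f) : Continuous f := hf.smooth.continuous

lemma sq_continuous (hf : SmoothPer f) : Continuous fun x => f x ^ 2 := hf.continuous.pow 2

lemma differentiable (hf : SmoothPer f) : Differentiable ℝ f :=
  hf.smooth.differentiable (by simp)

lemma hasDerivAt (hf : SmoothPer f) (x : ℝ) : HasDerivAt f (deriv f x) x :=
  (hf.differentiable x).hasDerivAt

lemma deriv (hf : SmoothPer f) : SmoothPer (deriv f) where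
  smooth := (contDiff_infty_iff_deriv.1 hf.smooth).2
  per x := by
    have h : (fun y => f (y + 1)) = f := funext hf.per
    rw [← deriv_comp_add_const, h]

lemma iter (hf : SmoothPer f) (n : ℕ) : SmoothPer (_root_.deriv^[n] f) := by
  induction n with
  | zero => exact hf
  | succ n ih => rw [Function.iterate_succ_apply']; exact ih.deriv

lemma const (c : ℝ) : SmoothPer fun _ => c := ⟨contDiff_const, fun _ => rfl⟩

lemma add (hf : SmoothPer f) (hg : SmoothPer g) : SmoothPer fun x => f x + g x :=
  ⟨hf.smooth.add hg.smooth, fun x => by simp [hf.per, hg.per]⟩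

lemma sub (hf : SmoothPer f) (hg : SmoothPer g) : SmoothPer fun x => f x - g x :=
  ⟨hf.smooth.sub hg.smooth, fun x => by simp [hf.per, hg.per]⟩

lemma neg (hf : SmoothPer f) : SmoothPer fun x => - f x :=
  ⟨hf.smooth.neg, fun x => by simp [hf.per]⟩

lemma mul (hf : SmoothPer f) (hg : SmoothPer g) : SmoothPer fun x => f x * g x :=
  ⟨hf.smooth.mul hg.smooth, fun x => by simp [hf.per, hg.per]⟩

lemma const_mul (c : ℝ) (hf : SmoothPer f) : SmoothPer fun x => c * f x :=
  (const c).mul hf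

lemma rpow (hf : SmoothPer f) (hpos : ∀ x, 0 < f x) (s : ℝ) : SmoothPer fun x => f x ^ s :=
  ⟨hf.smooth.rpow_const_of_ne fun x => (hpos x).ne', fun x => by simp [hf.per]⟩

lemma intervalIntegrable (hf : SmoothPer f) (a b : ℝ) :
    IntervalIntegrable f volume a b := hf.continuous.intervalIntegrable a b

lemma integral_deriv (hf : SmoothPer f) : ∫ x in (0:ℝ)..1, _root_.deriv f x = 0 := by
  rw [intervalIntegral.integral_eq_sub_of_hasDerivAt (fun x _ => hf.hasDerivAt x)
    (hf.deriv.intervalIntegrable 0 1)]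
  have h := hf.per 0
  rw [zero_add] at h
  rw [h, sub_self]

/-- Values of a periodic function are attained in the unit interval. -/
lemma exists_eq (hf : SmoothPer f) (x : ℝ) : ∃ y ∈ Set.Icc (0:ℝ) 1, f y = f x := by
  refine ⟨Int.fract x, ⟨Int.fract_nonneg x, (Int.fract_lt_one x).le⟩, ?_⟩
  have hp : Function.Periodic f 1 := hf.per
  have h := hp.sub_zsmul_eq (x := x) ⌊x⌋
  rwa [zsmul_one] at h

end SmoothPer

/-- A continuous function with zero mean on the unit interval vanishes somewhere there. -/
lemma exists_zero_of_integral_eq_zero {f : ℝ → ℝ} (hf : Continuous f)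
    (h : ∫ x in (0:ℝ)..1, f x = 0) : ∃ y ∈ Set.Icc (0:ℝ) 1, f y = 0 := by
  obtain ⟨y, hy, he⟩ := exists_eq_interval_average (f := f)
    (a := 0) (b := 1) (by norm_num) hf.continuousOn
  refine ⟨y, ?_, ?_⟩
  · have := Set.uIoo_subset_uIcc_self hy
    rwa [Set.uIcc_of_le zero_le_one] at this
  · rw [he, interval_average_eq]; simp [h]

/-- Squared `L²` norm on the unit interval. -/
noncomputable def l2 (f : ℝ → ℝ) : ℝ := ∫ x in (0:ℝ)..1, f x ^ 2

/-- Squared `L²` norm of the derivative of order `j`. -/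
noncomputable def nsq (j : ℕ) (f : ℝ → ℝ) : ℝ := l2 (deriv^[j] f)

lemma HSq_eq (k : ℕ) (f : ℝ → ℝ) : HSq k f = ∑ j ∈ Finset.range (k + 1), nsq j f := rfl

lemma l2_nonneg (f : ℝ → ℝ) : 0 ≤ l2 f :=
  intervalIntegral.integral_nonneg zero_le_one fun _ _ => sq_nonneg _

lemma nsq_nonneg (j : ℕ) (f : ℝ → ℝ) : 0 ≤ nsq j f := l2_nonneg _

lemma HSq_nonneg (k : ℕ) (f : ℝ → ℝ) : 0 ≤ HSq k f :=
  Finset.sum_nonneg fun _ _ => nsq_nonneg _ _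

lemma nsq_le_HSq {j k : ℕ} (h : j ≤ k) (f : ℝ → ℝ) : nsq j f ≤ HSq k f :=
  Finset.single_le_sum (f := fun j => nsq j f) (fun _ _ => nsq_nonneg _ _)
    (Finset.mem_range.2 (by omega))

lemma HSq_mono {j k : ℕ} (h : j ≤ k) (f : ℝ → ℝ) : HSq j f ≤ HSq k f :=
  Finset.sum_le_sum_of_subset_of_nonneg (Finset.range_mono (by omega))
    fun _ _ _ => nsq_nonneg _ _

lemma HSq_succ (k : ℕ) (f : ℝ → ℝ) : HSq (k + 1) f = nsq 0 f + HSq k (deriv f) := by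
  rw [HSq_eq, Finset.sum_range_succ', add_comm]; rfl

lemma nsq_succ (j : ℕ) (f : ℝ → ℝ) : nsq (j + 1) f = nsq j (deriv f) := rfl

lemma HSq_deriv_le (k : ℕ) (f : ℝ → ℝ) : HSq k (deriv f) ≤ HSq (k + 1) f := by
  rw [HSq_succ]; linarith [nsq_nonneg 0 f]

/-- Monotonicity of the integral over the unit interval for continuous integrands. -/
lemma integral_le {f g : ℝ → ℝ} (hf : Continuous f) (hg : Continuous g)
    (h : ∀ x, f x ≤ g x) : ∫ x in (0:ℝ)..1, f x ≤ ∫ x in (0:ℝ)..1, g x :=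
  intervalIntegral.integral_mono zero_le_one (hf.intervalIntegrable _ _)
    (hg.intervalIntegrable _ _) h

lemma integral_add' {f g : ℝ → ℝ} (hf : Continuous f) (hg : Continuous g) :
    ∫ x in (0:ℝ)..1, (f x + g x) = (∫ x in (0:ℝ)..1, f x) + ∫ x in (0:ℝ)..1, g x :=
  intervalIntegral.integral_add (hf.intervalIntegrable _ _) (hg.intervalIntegrable _ _)

lemma l2_add_le {f g : ℝ → ℝ} (hf : Continuous f) (hg : Continuous g) :
    l2 (fun x => f x + g x) ≤ 2 * l2 f + 2 * l2 g := by
  unfold l2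
  rw [← intervalIntegral.integral_const_mul, ← intervalIntegral.integral_const_mul,
    ← integral_add' (by fun_prop) (by fun_prop)]
  exact integral_le (by fun_prop) (by fun_prop) fun x => by nlinarith [sq_nonneg (f x - g x)]

lemma l2_const_mul (c : ℝ) (f : ℝ → ℝ) : l2 (fun x => c * f x) = c ^ 2 * l2 f := by
  unfold l2
  rw [← intervalIntegral.integral_const_mul]
  congr 1; ext x; ring

lemma l2_neg (f : ℝ → ℝ) : l2 (fun x => - f x) = l2 f := by simp [l2]

lemma l2_sub_le {f g : ℝ → ℝ} (hf : Continuous f) (hg : Continuous g) :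
    l2 (fun x => f x - g x) ≤ 2 * l2 f + 2 * l2 g := by
  have h := l2_add_le hf hg.neg
  rw [show l2 (-g) = l2 g from l2_neg g] at h
  simpa only [sub_eq_add_neg, Pi.neg_apply] using h

lemma l2_mul_le {f g : ℝ → ℝ} (hf : Continuous f) (hg : Continuous g) {K : ℝ}
    (h : ∀ x, f x ^ 2 ≤ K) : l2 (fun x => f x * g x) ≤ K * l2 g := by
  unfold l2
  rw [← intervalIntegral.integral_const_mul]
  refine integral_le (by fun_prop) (by fun_prop) fun x => ?_
  rw [mul_pow]; exact mul_le_mul_of_nonneg_right (h x) (sq_nonneg _)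

lemma l2_mul_le' {f g : ℝ → ℝ} (hf : Continuous f) (hg : Continuous g) {K : ℝ}
    (h : ∀ x, g x ^ 2 ≤ K) : l2 (fun x => f x * g x) ≤ K * l2 f := by
  simpa [mul_comm] using l2_mul_le hg hf h

lemma l2_sum_le {ι : Type*} (s : Finset ι) {F : ι → ℝ → ℝ}
    (hF : ∀ i ∈ s, Continuous (F i)) :
    l2 (fun x => ∑ i ∈ s, F i x) ≤ s.card * ∑ i ∈ s, l2 (F i) := by
  unfold l2
  have h := intervalIntegral.integral_finsetSum (μ := volume) (a := 0) (b := 1) (s := s)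
    (f := fun i x => F i x ^ 2) fun i hi => ((hF i hi).pow 2).intervalIntegrable _ _
  rw [← h, ← intervalIntegral.integral_const_mul]
  refine integral_le ((continuous_finsetSum s hF).pow 2)
    (continuous_const.mul (continuous_finsetSum s fun i hi => (hF i hi).pow 2)) fun x => ?_
  exact sq_sum_le_card_mul_sum_sq

/-- Jensen's inequality for the square. -/
lemma sq_integral_le {f : ℝ → ℝ} (hf : Continuous f) :
    (∫ x in (0:ℝ)..1, f x) ^ 2 ≤ l2 f := by
  set c := ∫ x in (0:ℝ)..1, f x with hc
  have h : ∫ x in (0:ℝ)..1, 2 * c * f x ≤ ∫ x in (0:ℝ)..1, (c ^ 2 + f x ^ 2) :=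
    integral_le (by fun_prop) (by fun_prop) fun x => by nlinarith [sq_nonneg (c - f x)]
  rw [intervalIntegral.integral_const_mul, integral_add' (by fun_prop) (by fun_prop), ← hc] at h
  simp at h
  unfold l2
  nlinarith

/-- A function vanishing somewhere is bounded by the `L¹` norm of its derivative. -/
lemma SmoothPer.abs_sub_le {f : ℝ → ℝ} (hf : SmoothPer f) {x y : ℝ}
    (hx : x ∈ Set.Icc (0:ℝ) 1) (hy : y ∈ Set.Icc (0:ℝ) 1) :
    |f x - f y| ≤ ∫ z in (0:ℝ)..1, |_root_.deriv f z| := by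
  rw [← intervalIntegral.integral_eq_sub_of_hasDerivAt (fun z _ => hf.hasDerivAt z)
    (hf.deriv.intervalIntegrable y x)]
  rw [← Real.norm_eq_abs]
  refine intervalIntegral.norm_integral_le_integral_norm_uIoc.trans ?_
  rw [intervalIntegral.integral_of_le zero_le_one]
  refine setIntegral_mono_set ?_ (Filter.Eventually.of_forall fun z => norm_nonneg _) ?_
  · exact (hf.deriv.continuous.abs.intervalIntegrable 0 1).1
  · refine Filter.Eventually.of_forall ?_
    intro z hz
    rw [Set.uIoc] at hz
    exact ⟨lt_of_le_of_lt (le_min hy.1 hx.1) hz.1, hz.2.trans (max_le hy.2 hx.2)⟩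

lemma SmoothPer.sq_sub_le {f : ℝ → ℝ} (hf : SmoothPer f) (x : ℝ) {y : ℝ}
    (hy : y ∈ Set.Icc (0:ℝ) 1) : (f x - f y) ^ 2 ≤ nsq 1 f := by
  obtain ⟨z, hz, hzx⟩ := hf.exists_eq x
  rw [← hzx, ← sq_abs]
  have h := hf.abs_sub_le hz hy
  refine (pow_le_pow_left₀ (abs_nonneg _) h 2).trans
    ((sq_integral_le hf.deriv.continuous.abs).trans ?_)
  simp [l2, nsq]

lemma SmoothPer.sq_le_of_zero {f : ℝ → ℝ} (hf : SmoothPer f) {y : ℝ}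
    (hy : y ∈ Set.Icc (0:ℝ) 1) (h0 : f y = 0) (x : ℝ) : f x ^ 2 ≤ nsq 1 f := by
  simpa [h0] using hf.sq_sub_le x hy

/-- Derivatives of positive order are bounded by the `L²` norm of the next one. -/
lemma SmoothPer.sq_iter_le {f : ℝ → ℝ} (hf : SmoothPer f) {j : ℕ} (hj : 1 ≤ j) (x : ℝ) :
    (_root_.deriv^[j] f x) ^ 2 ≤ nsq (j + 1) f := by
  obtain ⟨j, rfl⟩ : ∃ i, j = i + 1 := ⟨j - 1, by omega⟩
  have h0 : ∫ x in (0:ℝ)..1, _root_.deriv^[j + 1] f x = 0 := by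
    rw [Function.iterate_succ_apply']; exact (hf.iter j).integral_deriv
  obtain ⟨y, hy, hy0⟩ := exists_zero_of_integral_eq_zero (hf.iter (j + 1)).continuous h0
  have h := (hf.iter (j + 1)).sq_le_of_zero hy hy0 x
  have e : nsq (j + 1 + 1) f = nsq 1 (_root_.deriv^[j + 1] f) := by
    rw [nsq, Function.iterate_succ_apply', nsq, Function.iterate_one]
  rw [e]
  exact h

lemma l2_le_of_sq_le {f : ℝ → ℝ} (hf : Continuous f) {K : ℝ} (h : ∀ x, f x ^ 2 ≤ K) :
    l2 f ≤ K := by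
  have := integral_le (hf.pow 2) continuous_const h
  simpa [l2] using this

/-- The Sobolev embedding `H¹ ⊂ L^∞` on the circle. -/
lemma SmoothPer.sq_le {f : ℝ → ℝ} (hf : SmoothPer f) (x : ℝ) : f x ^ 2 ≤ 2 * HSq 1 f := by
  set c := ∫ x in (0:ℝ)..1, f x with hc
  have h0 : ∫ x in (0:ℝ)..1, (f x - c) = 0 := by
    rw [intervalIntegral.integral_sub (hf.intervalIntegrable _ _) (by simp)]; simp [hc]
  obtain ⟨y, hy, hy0⟩ := exists_zero_of_integral_eq_zero (hf.continuous.sub continuous_const) h0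
  have h1 := hf.sq_sub_le x hy
  have h2 := sq_integral_le hf.continuous
  have h3 : HSq 1 f = nsq 0 f + nsq 1 f := by simp [HSq_eq, Finset.sum_range_succ]
  have h4 : nsq 0 f = l2 f := rfl
  rw [h3, h4]
  have h5 : f y = c := sub_eq_zero.1 hy0
  rw [h5] at h1
  nlinarith [sq_nonneg (f x - c - c)]

lemma SmoothPer.sq_iter_le_HSq {f : ℝ → ℝ} (hf : SmoothPer f) {j k : ℕ} (hj : j + 1 ≤ k)
    (x : ℝ) : (_root_.deriv^[j] f x) ^ 2 ≤ 2 * HSq k f := by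
  refine ((hf.iter j).sq_le x).trans ?_
  have h3 : HSq 1 (_root_.deriv^[j] f) = nsq j f + nsq (j + 1) f := by
    simp [HSq_eq, Finset.sum_range_succ, nsq, Function.iterate_succ_apply']
  have : nsq j f + nsq (j + 1) f ≤ HSq (j + 1) f := by
    rw [HSq_eq, Finset.sum_range_succ, Finset.sum_range_succ]
    have : 0 ≤ ∑ i ∈ Finset.range j, nsq i f := Finset.sum_nonneg fun _ _ => nsq_nonneg _ _
    linarith
  linarith [HSq_mono hj f]

/-- Leibniz rule. -/
lemma iter_mul {f g : ℝ → ℝ} (hf : SmoothPer f) (hg : SmoothPer g) (n : ℕ) :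
    deriv^[n] (fun x => f x * g x) = fun x => ∑ i ∈ Finset.range (n + 1),
      (n.choose i : ℝ) * (deriv^[i] f x * deriv^[n - i] g x) := by
  ext x
  have h := iteratedDeriv_mul (n := n) (x := x) (contDiff_infty.1 hf.smooth n).contDiffAt
    (contDiff_infty.1 hg.smooth n).contDiffAt
  rw [← iteratedDeriv_eq_iterate]
  simp only [← iteratedDeriv_eq_iterate, ← mul_assoc]
  exact h

lemma iter_add {f g : ℝ → ℝ} (hf : SmoothPer f) (hg : SmoothPer g) (n : ℕ) :
    deriv^[n] (fun x => f x + g x) = fun x => deriv^[n] f x + deriv^[n] g x := by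
  induction n with
  | zero => rfl
  | succ n ih =>
    ext x
    simp only [Function.iterate_succ_apply', ih]
    exact deriv_fun_add ((hf.iter n).differentiable x) ((hg.iter n).differentiable x)

lemma iter_const_mul {f : ℝ → ℝ} (hf : SmoothPer f) (c : ℝ) (n : ℕ) :
    deriv^[n] (fun x => c * f x) = fun x => c * deriv^[n] f x := by
  induction n with
  | zero => rfl
  | succ n ih =>
    ext x
    simp only [Function.iterate_succ_apply', ih]
    exact deriv_const_mul c ((hf.iter n).differentiable x)

lemma iter_sub {f g : ℝ → ℝ} (hf : SmoothPer f) (hg : SmoothPer g) (n : ℕ) :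
    deriv^[n] (fun x => f x - g x) = fun x => deriv^[n] f x - deriv^[n] g x := by
  have h := iter_add hf (hg.const_mul (-1)) n
  rw [iter_const_mul hg] at h
  ext x
  have h2 := congrFun h x
  simpa only [neg_one_mul, ← sub_eq_add_neg] using h2

lemma iter_neg {f : ℝ → ℝ} (hf : SmoothPer f) (n : ℕ) :
    deriv^[n] (fun x => - f x) = fun x => - deriv^[n] f x := by
  have h := iter_const_mul hf (-1) n
  simpa only [neg_one_mul] using h

lemma HSq_add_le {f g : ℝ → ℝ} (hf : SmoothPer f) (hg : SmoothPer g) (k : ℕ) :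
    HSq k (fun x => f x + g x) ≤ 2 * HSq k f + 2 * HSq k g := by
  simp only [HSq_eq, Finset.mul_sum, ← Finset.sum_add_distrib]
  refine Finset.sum_le_sum fun j _ => ?_
  rw [nsq, iter_add hf hg]
  exact l2_add_le (hf.iter j).continuous (hg.iter j).continuous

lemma HSq_const_mul {f : ℝ → ℝ} (hf : SmoothPer f) (c : ℝ) (k : ℕ) :
    HSq k (fun x => c * f x) = c ^ 2 * HSq k f := by
  simp only [HSq_eq, Finset.mul_sum]
  refine Finset.sum_congr rfl fun j _ => ?_
  rw [nsq, iter_const_mul hf, l2_const_mul]; rfl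

lemma HSq_neg {f : ℝ → ℝ} (hf : SmoothPer f) (k : ℕ) :
    HSq k (fun x => - f x) = HSq k f := by
  have h := HSq_const_mul hf (-1) k
  simpa using h

lemma HSq_sub_le {f g : ℝ → ℝ} (hf : SmoothPer f) (hg : SmoothPer g) (k : ℕ) :
    HSq k (fun x => f x - g x) ≤ 2 * HSq k f + 2 * HSq k g := by
  have h := HSq_add_le hf hg.neg k
  rw [HSq_neg hg] at h
  simpa only [← sub_eq_add_neg] using h

lemma l2_leibniz_le {f g : ℝ → ℝ} (hf : SmoothPer f) (hg : SmoothPer g) {n : ℕ}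
    (s : Finset ℕ) (hs : s ⊆ Finset.range (n + 1)) {K : ℝ} (hK : 0 ≤ K)
    (h : ∀ i ∈ s, l2 (fun x => deriv^[i] f x * deriv^[n - i] g x) ≤ K) :
    l2 (fun x => ∑ i ∈ s, (n.choose i : ℝ) * (deriv^[i] f x * deriv^[n - i] g x))
      ≤ (n + 1) ^ 2 * (2 ^ n) ^ 2 * K := by
  have hcard : (s.card : ℝ) ≤ n + 1 := by
    have := Finset.card_le_card hs
    rw [Finset.card_range] at this
    exact_mod_cast this
  refine (l2_sum_le s fun i _ => continuous_const.mul
    ((hf.iter i).continuous.mul (hg.iter (n - i)).continuous)).trans ?_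
  have h1 : ∀ i ∈ s, l2 (fun x => (n.choose i : ℝ) * (deriv^[i] f x * deriv^[n - i] g x))
      ≤ (2 ^ n) ^ 2 * K := by
    intro i hi
    rw [l2_const_mul]
    have hc : (n.choose i : ℝ) ≤ 2 ^ n := by exact_mod_cast Nat.choose_le_two_pow n i
    exact mul_le_mul (pow_le_pow_left₀ (by positivity) hc 2) (h i hi) (l2_nonneg _) (by positivity)
  have h2 := Finset.sum_le_card_nsmul s _ _ h1
  rw [nsmul_eq_mul] at h2
  have h3 : (s.card : ℝ) * ((2 ^ n) ^ 2 * K) ≤ (n + 1) * ((2 ^ n) ^ 2 * K) :=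
    mul_le_mul_of_nonneg_right hcard (by positivity)
  calc (s.card : ℝ) * _ ≤ (n + 1) * ((n + 1) * ((2 ^ n) ^ 2 * K)) :=
        mul_le_mul hcard (h2.trans h3)
          (Finset.sum_nonneg fun _ _ => l2_nonneg _) (by positivity)
    _ = _ := by ring

/-- `H^k` is an algebra for `k ≥ 1`. -/
lemma exists_HSq_mul_le {k : ℕ} (hk : 1 ≤ k) : ∃ C : ℝ, 0 < C ∧ ∀ f g : ℝ → ℝ,
    SmoothPer f → SmoothPer g → HSq k (fun x => f x * g x) ≤ C * (HSq k f * HSq k g) := by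
  refine ⟨∑ j ∈ Finset.range (k + 1), (j + 1 : ℝ) ^ 2 * (2 ^ j) ^ 2 * 2,
    Finset.sum_pos (fun j _ => by positivity) ⟨0, by simp⟩, fun f g hf hg => ?_⟩
  rw [HSq_eq, Finset.sum_mul]
  refine Finset.sum_le_sum fun j hj => ?_
  have hjk : j ≤ k := by have := Finset.mem_range.1 hj; omega
  have hfn := HSq_nonneg k f
  have hgn := HSq_nonneg k g
  rw [nsq, iter_mul hf hg, mul_assoc]
  refine l2_leibniz_le hf hg _ subset_rfl (by positivity) fun i hi => ?_
  have hij : i ≤ j := by have := Finset.mem_range.1 hi; omega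
  by_cases hik : i + 1 ≤ k
  · refine (l2_mul_le (hf.iter i).continuous (hg.iter _).continuous
      (hf.sq_iter_le_HSq hik)).trans ?_
    rw [← mul_assoc]
    exact mul_le_mul_of_nonneg_left (nsq_le_HSq (by omega) g) (by positivity)
  · refine (l2_mul_le' (hf.iter i).continuous (hg.iter _).continuous
      (hg.sq_iter_le_HSq (j := j - i) (k := k) (by omega))).trans ?_
    rw [mul_comm (HSq k f), ← mul_assoc]
    exact mul_le_mul_of_nonneg_left (nsq_le_HSq (by omega) f) (by positivity)

/-! ### Real powers of bounded positive functions -/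

lemma rpow_le_add {lo hi y : ℝ} (hlo : 0 < lo) (h1 : lo ≤ y) (h2 : y ≤ hi) (s : ℝ) :
    y ^ s ≤ lo ^ s + hi ^ s := by
  have p1 : 0 < lo ^ s := Real.rpow_pos_of_pos hlo s
  have p2 : 0 < hi ^ s := Real.rpow_pos_of_pos (hlo.trans_le (h1.trans h2)) s
  rcases le_total 0 s with hs | hs
  · linarith [Real.rpow_le_rpow (hlo.le.trans h1) h2 hs]
  · linarith [Real.rpow_le_rpow_of_nonpos hlo h1 hs]

lemma min_le_rpow {lo hi y : ℝ} (hlo : 0 < lo) (h1 : lo ≤ y) (h2 : y ≤ hi) (s : ℝ) :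
    min (lo ^ s) (hi ^ s) ≤ y ^ s := by
  rcases le_total 0 s with hs | hs
  · exact (min_le_left _ _).trans (Real.rpow_le_rpow hlo.le h1 hs)
  · exact (min_le_right _ _).trans (Real.rpow_le_rpow_of_nonpos (hlo.trans_le h1) h2 hs)

lemma rpow_sq_le {lo hi y : ℝ} (hlo : 0 < lo) (h1 : lo ≤ y) (h2 : y ≤ hi) (s : ℝ) :
    (y ^ s) ^ 2 ≤ (lo ^ s + hi ^ s) ^ 2 :=
  pow_le_pow_left₀ (Real.rpow_nonneg (hlo.le.trans h1) s) (rpow_le_add hlo h1 h2 s) 2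

lemma SmoothPer.deriv_rpow {h : ℝ → ℝ} (hh : SmoothPer h) (hpos : ∀ x, 0 < h x) (s : ℝ) :
    _root_.deriv (fun x => h x ^ s) = fun x => s * (h x ^ (s - 1) * _root_.deriv h x) := by
  ext x
  rw [((hh.hasDerivAt x).rpow_const (Or.inl (hpos x).ne')).deriv]
  ring

/-- Composition with a power does not increase Sobolev regularity of the derivative. -/
lemma exists_HSq_deriv_rpow_le (k : ℕ) {lo hi M : ℝ} (hlo : 0 < lo) (hM : 0 ≤ M) (s : ℝ) :
    ∃ C : ℝ, 0 < C ∧ ∀ h : ℝ → ℝ, SmoothPer h → (∀ x, lo ≤ h x) → (∀ x, h x ≤ hi) →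
      HSq k h ≤ M → HSq k (deriv fun x => h x ^ s) ≤ C * HSq k (deriv h) := by
  induction k generalizing s with
  | zero =>
    refine ⟨s ^ 2 * (lo ^ (s - 1) + hi ^ (s - 1)) ^ 2 + 1, by positivity,
      fun h hh h1 h2 _ => ?_⟩
    have hpos : ∀ x, 0 < h x := fun x => hlo.trans_le (h1 x)
    rw [hh.deriv_rpow hpos, HSq_const_mul ((hh.rpow hpos _).mul hh.deriv)]
    have hn := HSq_nonneg 0 (deriv h)
    have key : HSq 0 (fun x => h x ^ (s - 1) * deriv h x)
        ≤ (lo ^ (s - 1) + hi ^ (s - 1)) ^ 2 * HSq 0 (deriv h) := by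
      simp only [HSq_eq, zero_add, Finset.sum_range_one]
      exact l2_mul_le (hh.rpow hpos _).continuous hh.deriv.continuous
        fun x => rpow_sq_le hlo (h1 x) (h2 x) _
    nlinarith [sq_nonneg s]
  | succ k ih =>
    obtain ⟨C1, hC1, ih⟩ := ih (s - 1)
    obtain ⟨C2, hC2, halg⟩ := exists_HSq_mul_le (k := k + 1) (by omega)
    refine ⟨s ^ 2 * (C2 * ((lo ^ (s - 1) + hi ^ (s - 1)) ^ 2 + C1 * M)) + 1, by positivity,
      fun h hh h1 h2 hb => ?_⟩
    have hpos : ∀ x, 0 < h x := fun x => hlo.trans_le (h1 x)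
    have hr := hh.rpow hpos (s - 1)
    rw [hh.deriv_rpow hpos, HSq_const_mul (hr.mul hh.deriv)]
    have hn := HSq_nonneg (k + 1) (deriv h)
    have h3 : HSq (k + 1) (fun x => h x ^ (s - 1))
        ≤ (lo ^ (s - 1) + hi ^ (s - 1)) ^ 2 + C1 * M := by
      rw [HSq_succ]
      refine add_le_add (l2_le_of_sq_le hr.continuous
        fun x => rpow_sq_le hlo (h1 x) (h2 x) _) ?_
      refine (ih h hh h1 h2 ((HSq_mono (Nat.le_succ k) h).trans hb)).trans ?_
      exact mul_le_mul_of_nonneg_left ((HSq_deriv_le k h).trans hb) hC1.le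
    have h4 := (halg _ _ hr hh.deriv).trans
      (mul_le_mul_of_nonneg_left (mul_le_mul_of_nonneg_right h3 hn) hC2.le)
    nlinarith [mul_le_mul_of_nonneg_left h4 (sq_nonneg s)]

/-! ### Estimates at a fixed time -/

/-- Velocity `W` and specific volume `u` at a fixed time: `u` is bounded above and below and `W`
vanishes somewhere. -/
structure Slice (lo hi : ℝ) (W u : ℝ → ℝ) : Prop where
  hW : SmoothPer W
  hu : SmoothPer u
  lo_le : ∀ x, lo ≤ u x
  le_hi : ∀ x, u x ≤ hi
  zero : ∃ y ∈ Set.Icc (0:ℝ) 1, W y = 0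

/-- The effective velocity. -/
noncomputable def veff (ν : ℝ) (W u : ℝ → ℝ) : ℝ → ℝ := fun x => W x - ν * deriv u x

/-- Time derivative of the velocity according to the momentum equation. -/
noncomputable def dtW (a γ ν : ℝ) (W u : ℝ → ℝ) : ℝ → ℝ := fun x =>
  -(W x * deriv W x) + (ν * (u x * deriv (deriv W) x) + a * γ * (u x ^ (-γ) * deriv u x))

/-- Time derivative of the effective velocity. -/
noncomputable def dtV (a γ ν : ℝ) (W u : ℝ → ℝ) : ℝ → ℝ := fun x =>
  -(W x * deriv (veff ν W u) x) + a * γ * (u x ^ (-γ) * deriv u x)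

/-- Energy of order `k`. -/
noncomputable def energy (k : ℕ) (W u : ℝ → ℝ) : ℝ := HSq k W + HSq (k - 1) (deriv u)

/-- Dissipation of order `k`. -/
noncomputable def diss (k : ℕ) (W u : ℝ → ℝ) : ℝ := HSq (k + 1) W + HSq (k - 1) (deriv u)

lemma energy_nonneg (k : ℕ) (W u : ℝ → ℝ) : 0 ≤ energy k W u :=
  add_nonneg (HSq_nonneg _ _) (HSq_nonneg _ _)

lemma diss_nonneg (k : ℕ) (W u : ℝ → ℝ) : 0 ≤ diss k W u :=
  add_nonneg (HSq_nonneg _ _) (HSq_nonneg _ _)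

lemma energy_le_diss (k : ℕ) (W u : ℝ → ℝ) : energy k W u ≤ diss k W u :=
  add_le_add (HSq_mono (Nat.le_succ k) W) le_rfl

lemma energy_mono {j k : ℕ} (h : j ≤ k) (W u : ℝ → ℝ) : energy j W u ≤ energy k W u :=
  add_le_add (HSq_mono h W) (HSq_mono (by omega) _)

lemma SmoothPer.veff {W u : ℝ → ℝ} (hW : SmoothPer W) (hu : SmoothPer u) (ν : ℝ) :
    SmoothPer (veff ν W u) := hW.sub (hu.deriv.const_mul ν)

lemma Slice.sq_iter_le {lo hi : ℝ} {W u : ℝ → ℝ} (h : Slice lo hi W u) (i : ℕ) (x : ℝ) :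
    (deriv^[i] W x) ^ 2 ≤ nsq (i + 1) W := by
  rcases Nat.eq_zero_or_pos i with rfl | hi
  · obtain ⟨y, hy, hy0⟩ := h.zero
    exact h.hW.sq_le_of_zero hy hy0 x
  · exact h.hW.sq_iter_le hi x

lemma HSq_le_of_deriv {u : ℝ → ℝ} (hu : SmoothPer u) {hi : ℝ} (h0 : ∀ x, 0 ≤ u x)
    (h : ∀ x, u x ≤ hi) (k : ℕ) : HSq k u ≤ hi ^ 2 + HSq k (deriv u) := by
  have h1 : nsq 0 u ≤ hi ^ 2 :=
    l2_le_of_sq_le hu.continuous fun x => pow_le_pow_left₀ (h0 x) (h x) 2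
  exact ((HSq_mono (Nat.le_succ k) u).trans_eq (HSq_succ k u)).trans (add_le_add h1 le_rfl)

lemma HSq_veff_le {W u : ℝ → ℝ} (hW : SmoothPer W) (hu : SmoothPer u) (ν : ℝ) (k : ℕ) :
    HSq k (veff ν W u) ≤ 2 * HSq k W + 2 * ν ^ 2 * HSq k (deriv u) := by
  have h := HSq_sub_le hW (hu.deriv.const_mul ν) k
  rw [HSq_const_mul hu.deriv] at h
  rw [mul_assoc]
  exact h

/-- Leibniz rule with the term carrying all derivatives on the second factor isolated. -/
lemma iter_mul_eq_add {f g : ℝ → ℝ} (hf : SmoothPer f) (hg : SmoothPer g) (n : ℕ) :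
    deriv^[n] (fun x => f x * g x) = fun x => f x * deriv^[n] g x +
      ∑ i ∈ (Finset.range (n + 1)).erase 0,
        (n.choose i : ℝ) * (deriv^[i] f x * deriv^[n - i] g x) := by
  rw [iter_mul hf hg]
  ext x
  rw [← Finset.add_sum_erase _ _ (show 0 ∈ Finset.range (n + 1) by simp)]
  simp

/-- Leibniz remainder in the pressure term. -/
lemma exists_pressure_remainder_le (γ : ℝ) (m : ℕ) {lo hi M : ℝ} (hlo : 0 < lo) (hM : 0 ≤ M) :
    ∃ C : ℝ, 0 < C ∧ ∀ W u : ℝ → ℝ, Slice lo hi W u → HSq (m - 1) (deriv u) ≤ M →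
      l2 (fun x => ∑ i ∈ (Finset.range (m + 1)).erase 0,
        (m.choose i : ℝ) * (deriv^[i] (fun x => u x ^ (-γ)) x * deriv^[m - i] (deriv u) x))
        ≤ C * (diss m W u * energy (m + 1) W u) := by
  obtain ⟨C, hC, hp⟩ := exists_HSq_deriv_rpow_le (m - 1) (lo := lo) (hi := hi)
    (M := hi ^ 2 + M) hlo (by positivity) (-γ)
  refine ⟨(m + 1) ^ 2 * (2 ^ m) ^ 2 * C, by positivity, fun W u h hu => ?_⟩
  have hpos : ∀ x, 0 < u x := fun x => hlo.trans_le (h.lo_le x)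
  have hQ := h.hu.rpow hpos (-γ)
  have hq := hp u h.hu h.lo_le h.le_hi
    ((HSq_le_of_deriv h.hu (fun x => (hpos x).le) h.le_hi _).trans (by linarith))
  have hd := diss_nonneg m W u
  have he := energy_nonneg (m + 1) W u
  rw [mul_assoc]
  refine l2_leibniz_le hQ h.hu.deriv _ (Finset.erase_subset _ _) (by positivity) fun i hi => ?_
  obtain ⟨hi0, him⟩ := Finset.mem_erase.1 hi
  have him : i ≤ m := by have := Finset.mem_range.1 him; omega
  have hs : ∀ x, (deriv^[m - i] (deriv u) x) ^ 2 ≤ energy (m + 1) W u := fun x => by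
    refine (h.hu.sq_iter_le (j := m - i + 1) (by omega) x).trans ?_
    rw [nsq_succ]
    refine (nsq_le_HSq (k := m) (by omega) _).trans ?_
    exact le_add_of_nonneg_left (HSq_nonneg _ _)
  have hl : l2 (deriv^[i] fun x => u x ^ (-γ)) ≤ C * diss m W u := by
    obtain ⟨j, rfl⟩ : ∃ j, i = j + 1 := ⟨i - 1, by omega⟩
    refine (nsq_le_HSq (j := j) (k := m - 1) (by omega) (deriv fun x => u x ^ (-γ))).trans
      (hq.trans ?_)
    exact mul_le_mul_of_nonneg_left (le_add_of_nonneg_left (HSq_nonneg _ _)) hC.le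
  refine (l2_mul_le' (hQ.iter i).continuous (h.hu.deriv.iter _).continuous hs).trans ?_
  calc _ ≤ energy (m + 1) W u * (C * diss m W u) := mul_le_mul_of_nonneg_left hl he
    _ = _ := by ring

/-- Commutator bound for the momentum equation. -/
lemma exists_dtW_remainder_le (a γ ν : ℝ) (m : ℕ) {lo hi M : ℝ} (hlo : 0 < lo) (hM : 0 ≤ M) :
    ∃ C : ℝ, 0 < C ∧ ∀ W u : ℝ → ℝ, Slice lo hi W u → HSq (m - 1) (deriv u) ≤ M →
      l2 (fun x => deriv^[m] (dtW a γ ν W u) x - ν * (u x * deriv^[m + 2] W x))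
        ≤ C * (nsq m (deriv u) + diss m W u * (1 + energy (m + 1) W u)) := by
  obtain ⟨C, hC, hp⟩ := exists_pressure_remainder_le γ m (hi := hi) hlo hM
  set L : ℝ := (m + 1) ^ 2 * (2 ^ m) ^ 2 with hL
  set q : ℝ := (lo ^ (-γ) + hi ^ (-γ)) ^ 2 with hq
  refine ⟨2 * L + 4 * (ν ^ 2 * L) + 8 * ((a * γ) ^ 2 * (q + C)) + 1, by positivity,
    fun W u h hu => ?_⟩
  have hpos : ∀ x, 0 < u x := fun x => hlo.trans_le (h.lo_le x)
  have hQ := h.hu.rpow hpos (-γ)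
  have h1 : SmoothPer fun x => W x * deriv W x := h.hW.mul h.hW.deriv
  have h2 : SmoothPer fun x => u x * deriv (deriv W) x := h.hu.mul h.hW.deriv.deriv
  have h3 : SmoothPer fun x => u x ^ (-γ) * deriv u x := hQ.mul h.hu.deriv
  set E := energy (m + 1) W u with hE
  set D := diss m W u with hD
  have hE0 : 0 ≤ E := energy_nonneg _ _ _
  have hD0 : 0 ≤ D := diss_nonneg _ _ _
  have hWD : HSq (m + 1) W ≤ D := le_add_of_nonneg_right (HSq_nonneg _ _)
  have hWE : HSq (m + 1) W ≤ E := le_add_of_nonneg_right (HSq_nonneg _ _)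
  have huE : HSq m (deriv u) ≤ E := le_add_of_nonneg_left (HSq_nonneg _ _)
  have t1 : l2 (deriv^[m] fun x => W x * deriv W x) ≤ L * (D * E) := by
    rw [iter_mul h.hW h.hW.deriv]
    refine l2_leibniz_le h.hW h.hW.deriv _ subset_rfl (by positivity) fun i hi => ?_
    have him : i ≤ m := by have := Finset.mem_range.1 hi; omega
    refine (l2_mul_le (h.hW.iter i).continuous (h.hW.deriv.iter _).continuous
      (h.sq_iter_le i)).trans ?_
    exact mul_le_mul ((nsq_le_HSq (by omega) W).trans hWD)
      ((nsq_le_HSq (j := m - i + 1) (by omega) W).trans hWE) (l2_nonneg _) hD0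
  set B : ℝ → ℝ := fun x => ∑ i ∈ (Finset.range (m + 1)).erase 0,
    (m.choose i : ℝ) * (deriv^[i] u x * deriv^[m - i] (deriv (deriv W)) x) with hB
  have t2 : l2 B ≤ L * (D * E) := by
    refine l2_leibniz_le h.hu h.hW.deriv.deriv _ (Finset.erase_subset _ _) (by positivity)
      fun i hi => ?_
    obtain ⟨hi0, him⟩ := Finset.mem_erase.1 hi
    have him : i ≤ m := by have := Finset.mem_range.1 him; omega
    refine (l2_mul_le (h.hu.iter i).continuous (h.hW.deriv.deriv.iter _).continuous
      (h.hu.sq_iter_le (j := i) (by omega))).trans ?_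
    rw [mul_comm D]
    exact mul_le_mul ((nsq_le_HSq (j := i) (by omega) (deriv u)).trans huE)
      ((nsq_le_HSq (j := m - i + 2) (by omega) W).trans hWD) (l2_nonneg _) hE0
  have hBc : Continuous B := continuous_finsetSum _ fun i _ => continuous_const.mul
    ((h.hu.iter i).continuous.mul (h.hW.deriv.deriv.iter _).continuous)
  have t3 : l2 (deriv^[m] fun x => u x ^ (-γ) * deriv u x)
      ≤ 2 * (q * nsq m (deriv u)) + 2 * (C * (D * E)) := by
    rw [iter_mul_eq_add hQ h.hu.deriv]
    refine (l2_add_le (hQ.continuous.mul (h.hu.deriv.iter m).continuous)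
      (continuous_finsetSum _ fun i _ => continuous_const.mul
        ((hQ.iter i).continuous.mul (h.hu.deriv.iter _).continuous))).trans ?_
    refine add_le_add (mul_le_mul_of_nonneg_left ?_ zero_le_two)
      (mul_le_mul_of_nonneg_left (hp W u h hu) zero_le_two)
    exact l2_mul_le hQ.continuous (h.hu.deriv.iter m).continuous
      fun x => rpow_sq_le hlo (h.lo_le x) (h.le_hi x) _
  have hdec : (fun x => deriv^[m] (dtW a γ ν W u) x - ν * (u x * deriv^[m + 2] W x))
      = fun x => -(deriv^[m] (fun x => W x * deriv W x) x) + (ν * B x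
        + a * γ * deriv^[m] (fun x => u x ^ (-γ) * deriv u x) x) := by
    unfold dtW
    rw [iter_add h1.neg ((h2.const_mul ν).add (h3.const_mul (a * γ))), iter_neg h1,
      iter_add (h2.const_mul ν) (h3.const_mul (a * γ)), iter_const_mul h2, iter_const_mul h3,
      iter_mul_eq_add h.hu h.hW.deriv.deriv]
    ext x
    have e : deriv^[m] (deriv (deriv W)) x = deriv^[m + 2] W x := rfl
    simp only [e, hB]
    ring
  rw [hdec]
  have hc3 := (h3.iter m).continuous
  have hc1 := (h1.iter m).continuous
  have s1 := l2_add_le (f := fun x => -(deriv^[m] (fun x => W x * deriv W x) x))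
    (g := fun x => ν * B x + a * γ * deriv^[m] (fun x => u x ^ (-γ) * deriv u x) x)
    (by fun_prop) (by fun_prop)
  have s2 := l2_add_le (f := fun x => ν * B x)
    (g := fun x => a * γ * deriv^[m] (fun x => u x ^ (-γ) * deriv u x) x)
    (by fun_prop) (by fun_prop)
  rw [l2_const_mul, l2_const_mul] at s2
  rw [l2_neg] at s1
  have hr := nsq_nonneg m (deriv u)
  have hDE : 0 ≤ D * E := by positivity
  have hL0 : 0 ≤ L := by positivity
  have hq0 : 0 ≤ q := by positivity
  have u2 := mul_le_mul_of_nonneg_left t2 (sq_nonneg ν)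
  have u3 := mul_le_mul_of_nonneg_left t3 (sq_nonneg (a * γ))
  calc _ ≤ 2 * (L * (D * E)) + 4 * (ν ^ 2 * (L * (D * E))) + 4 * ((a * γ) ^ 2 *
        (2 * (q * nsq m (deriv u)) + 2 * (C * (D * E)))) := by linarith
    _ ≤ (2 * L + 4 * (ν ^ 2 * L) + 8 * ((a * γ) ^ 2 * (q + C)) + 1) *
        (nsq m (deriv u) + D * E) := by
      have p1 : 0 ≤ L * nsq m (deriv u) := by positivity
      have p2 : 0 ≤ ν ^ 2 * (L * nsq m (deriv u)) := by positivity
      have p3 : 0 ≤ (a * γ) ^ 2 * (C * nsq m (deriv u)) := by positivity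
      have p4 : 0 ≤ (a * γ) ^ 2 * (q * (D * E)) := by positivity
      linarith
    _ ≤ _ := by
      refine mul_le_mul_of_nonneg_left ?_ (by positivity)
      linarith

/-- Commutator bound for the equation of the effective velocity. -/
lemma exists_dtV_remainder_le (a γ : ℝ) {ν : ℝ} (hν : 0 < ν) (m : ℕ) {lo hi M : ℝ}
    (hlo : 0 < lo) (hM : 0 ≤ M) :
    ∃ C : ℝ, 0 < C ∧ ∀ W u : ℝ → ℝ, Slice lo hi W u → HSq (m - 1) (deriv u) ≤ M →
      l2 (fun x => deriv^[m] (dtV a γ ν W u) x + (W x * deriv^[m + 1] (veff ν W u) x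
          + a * γ / ν * (u x ^ (-γ) * deriv^[m] (veff ν W u) x)))
        ≤ C * (diss m W u * (1 + energy (m + 1) W u)) := by
  obtain ⟨C, hC, hp⟩ := exists_pressure_remainder_le γ m (hi := hi) hlo hM
  set L : ℝ := (m + 1) ^ 2 * (2 ^ m) ^ 2 with hL
  set q : ℝ := (lo ^ (-γ) + hi ^ (-γ)) ^ 2 with hq
  refine ⟨2 * (L * (2 + 2 * ν ^ 2)) + 4 * ((a * γ / ν) ^ 2 * q) + 4 * ((a * γ) ^ 2 * C) + 1,
    by positivity, fun W u h hu => ?_⟩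
  have hpos : ∀ x, 0 < u x := fun x => hlo.trans_le (h.lo_le x)
  have hQ := h.hu.rpow hpos (-γ)
  have hV := h.hW.veff h.hu ν
  have h1 : SmoothPer fun x => W x * deriv (veff ν W u) x := h.hW.mul hV.deriv
  have h3 : SmoothPer fun x => u x ^ (-γ) * deriv u x := hQ.mul h.hu.deriv
  set E := energy (m + 1) W u with hE
  set D := diss m W u with hD
  have hE0 : 0 ≤ E := energy_nonneg _ _ _
  have hD0 : 0 ≤ D := diss_nonneg _ _ _
  have hWD : HSq (m + 1) W ≤ D := le_add_of_nonneg_right (HSq_nonneg _ _)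
  have hWE : HSq (m + 1) W ≤ E := le_add_of_nonneg_right (HSq_nonneg _ _)
  have huE : HSq m (deriv u) ≤ E := le_add_of_nonneg_left (HSq_nonneg _ _)
  have hVE : HSq m (veff ν W u) ≤ (2 + 2 * ν ^ 2) * E := by
    have := HSq_veff_le h.hW h.hu ν m
    have h5 := (HSq_mono (Nat.le_succ m) W).trans hWE
    nlinarith [mul_le_mul_of_nonneg_left huE (sq_nonneg ν)]
  set A : ℝ → ℝ := fun x => ∑ i ∈ (Finset.range (m + 1)).erase 0,
    (m.choose i : ℝ) * (deriv^[i] W x * deriv^[m - i] (deriv (veff ν W u)) x) with hA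
  set B : ℝ → ℝ := fun x => ∑ i ∈ (Finset.range (m + 1)).erase 0,
    (m.choose i : ℝ) * (deriv^[i] (fun x => u x ^ (-γ)) x * deriv^[m - i] (deriv u) x) with hB
  have hAc : Continuous A := continuous_finsetSum _ fun i _ => continuous_const.mul
    ((h.hW.iter i).continuous.mul (hV.deriv.iter _).continuous)
  have hBc : Continuous B := continuous_finsetSum _ fun i _ => continuous_const.mul
    ((hQ.iter i).continuous.mul (h.hu.deriv.iter _).continuous)
  have t1 : l2 A ≤ L * (D * ((2 + 2 * ν ^ 2) * E)) := by
    refine l2_leibniz_le h.hW hV.deriv _ (Finset.erase_subset _ _) (by positivity)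
      fun i hi => ?_
    obtain ⟨hi0, him⟩ := Finset.mem_erase.1 hi
    have him : i ≤ m := by have := Finset.mem_range.1 him; omega
    refine (l2_mul_le (h.hW.iter i).continuous (hV.deriv.iter _).continuous
      (h.sq_iter_le i)).trans ?_
    exact mul_le_mul ((nsq_le_HSq (by omega) W).trans hWD)
      ((nsq_le_HSq (j := m - i + 1) (by omega) _).trans hVE) (l2_nonneg _) hD0
  have t2 : l2 (fun x => u x ^ (-γ) * deriv^[m] W x) ≤ q * D := by
    refine (l2_mul_le hQ.continuous (h.hW.iter m).continuous
      fun x => rpow_sq_le hlo (h.lo_le x) (h.le_hi x) _).trans ?_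
    exact mul_le_mul_of_nonneg_left ((nsq_le_HSq (by omega) W).trans hWD) (by positivity)
  have hdec : (fun x => deriv^[m] (dtV a γ ν W u) x + (W x * deriv^[m + 1] (veff ν W u) x
          + a * γ / ν * (u x ^ (-γ) * deriv^[m] (veff ν W u) x)))
      = fun x => -(A x) + (a * γ / ν * (u x ^ (-γ) * deriv^[m] W x) + a * γ * B x) := by
    unfold dtV
    rw [iter_add h1.neg (h3.const_mul (a * γ)), iter_neg h1,
      iter_const_mul h3, iter_mul_eq_add h.hW hV.deriv, iter_mul_eq_add hQ h.hu.deriv]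
    ext x
    have e : deriv^[m] (deriv (veff ν W u)) x = deriv^[m + 1] (veff ν W u) x := rfl
    have e2 : deriv^[m] (veff ν W u) x = deriv^[m] W x - ν * deriv^[m] (deriv u) x := by
      unfold veff
      rw [iter_sub h.hW (h.hu.deriv.const_mul ν), iter_const_mul h.hu.deriv]
    simp only [e, e2, hA, hB]
    field_simp
    ring
  rw [hdec]
  have hc2 := (h.hW.iter m).continuous
  have hcQ := hQ.continuous
  have s1 := l2_add_le (f := fun x => -(A x))
    (g := fun x => a * γ / ν * (u x ^ (-γ) * deriv^[m] W x) + a * γ * B x)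
    (by fun_prop) (by fun_prop)
  have s2 := l2_add_le (f := fun x => a * γ / ν * (u x ^ (-γ) * deriv^[m] W x))
    (g := fun x => a * γ * B x) (by fun_prop) (by fun_prop)
  rw [l2_const_mul, l2_const_mul] at s2
  rw [l2_neg] at s1
  have hDE : 0 ≤ D * E := by positivity
  have hL0 : 0 ≤ L := by positivity
  have hq0 : 0 ≤ q := by positivity
  have u2 := mul_le_mul_of_nonneg_left t2 (sq_nonneg (a * γ / ν))
  have u3 := mul_le_mul_of_nonneg_left (hp W u h hu) (sq_nonneg (a * γ))
  have p1 : 0 ≤ L * (2 + 2 * ν ^ 2) * D := by positivity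
  have p2 : 0 ≤ (a * γ / ν) ^ 2 * q * (D * E) := by positivity
  have p3 : 0 ≤ (a * γ) ^ 2 * C * D := by positivity
  nlinarith

lemma integral_mul_deriv {f g : ℝ → ℝ} (hf : SmoothPer f) (hg : SmoothPer g) :
    ∫ x in (0:ℝ)..1, f x * deriv g x = -∫ x in (0:ℝ)..1, deriv f x * g x := by
  have h := (hf.mul hg).integral_deriv
  have e : deriv (fun x => f x * g x) = fun x => deriv f x * g x + f x * deriv g x := by
    ext x
    exact deriv_fun_mul (hf.differentiable x) (hg.differentiable x)
  rw [e, integral_add' (hf.deriv.mul hg).continuous (hf.mul hg.deriv).continuous] at h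
  linarith

lemma SmoothPer.dtW {W u : ℝ → ℝ} (hW : SmoothPer W) (hu : SmoothPer u) (hpos : ∀ x, 0 < u x)
    (a γ ν : ℝ) : SmoothPer (dtW a γ ν W u) :=
  (hW.mul hW.deriv).neg.add (((hu.mul hW.deriv.deriv).const_mul ν).add
    (((hu.rpow hpos _).mul hu.deriv).const_mul (a * γ)))

lemma SmoothPer.dtV {W u : ℝ → ℝ} (hW : SmoothPer W) (hu : SmoothPer u) (hpos : ∀ x, 0 < u x)
    (a γ ν : ℝ) : SmoothPer (dtV a γ ν W u) :=
  (hW.mul (hW.veff hu ν).deriv).neg.add (((hu.rpow hpos _).mul hu.deriv).const_mul (a * γ))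

/-- Energy estimate for the velocity. -/
lemma exists_velocity_energy_le (a γ : ℝ) {ν : ℝ} (hν : 0 < ν) (m : ℕ) {lo hi M : ℝ}
    (hlo : 0 < lo) (hM : 0 ≤ M) :
    ∃ C : ℝ, 0 < C ∧ ∀ W u : ℝ → ℝ, Slice lo hi W u → HSq (m - 1) (deriv u) ≤ M →
      2 * ∫ x in (0:ℝ)..1, deriv^[m + 1] W x * deriv^[m + 1] (dtW a γ ν W u) x
        ≤ -(ν * lo) * nsq (m + 2) W
          + C * (nsq m (deriv u) + diss m W u * (1 + energy (m + 1) W u)) := by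
  obtain ⟨C, hC, hp⟩ := exists_dtW_remainder_le a γ ν m (hi := hi) hlo hM
  refine ⟨C / (ν * lo), by positivity, fun W u h hu => ?_⟩
  have hpos : ∀ x, 0 < u x := fun x => hlo.trans_le (h.lo_le x)
  have hT := h.hW.dtW h.hu hpos a γ ν
  set G : ℝ → ℝ := fun x => deriv^[m] (dtW a γ ν W u) x - ν * (u x * deriv^[m + 2] W x) with hG
  have hW2 := (h.hW.iter (m + 2)).continuous
  have hTm := (hT.iter m).continuous
  have huc := h.hu.continuous
  have hGc : Continuous G := by fun_prop
  have e1 : ∫ x in (0:ℝ)..1, deriv^[m + 1] W x * deriv^[m + 1] (dtW a γ ν W u) x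
      = -∫ x in (0:ℝ)..1, deriv^[m + 2] W x * deriv^[m] (dtW a γ ν W u) x := by
    have := integral_mul_deriv (h.hW.iter (m + 1)) (hT.iter m)
    simp only [← Function.iterate_succ_apply' deriv] at this
    exact this
  have e2 : ∫ x in (0:ℝ)..1, (-2) * (deriv^[m + 2] W x * deriv^[m] (dtW a γ ν W u) x)
      ≤ ∫ x in (0:ℝ)..1, (-(ν * lo) * deriv^[m + 2] W x ^ 2 + 1 / (ν * lo) * G x ^ 2) := by
    refine integral_le (by fun_prop) (by fun_prop) fun x => ?_
    have e3 : deriv^[m] (dtW a γ ν W u) x = ν * (u x * deriv^[m + 2] W x) + G x := by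
      simp only [hG]; ring
    rw [e3]
    set p := deriv^[m + 2] W x
    have h1 : ν * lo * p ^ 2 ≤ ν * u x * p ^ 2 :=
      mul_le_mul_of_nonneg_right (mul_le_mul_of_nonneg_left (h.lo_le x) hν.le) (sq_nonneg _)
    have h2 : 0 ≤ 1 / (ν * lo) * (ν * lo * p + G x) ^ 2 := by positivity
    have h3 : 1 / (ν * lo) * (ν * lo * p + G x) ^ 2
        = ν * lo * p ^ 2 + 2 * p * G x + 1 / (ν * lo) * G x ^ 2 := by field_simp; ring
    nlinarith
  rw [intervalIntegral.integral_const_mul, integral_add' (by fun_prop) (by fun_prop),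
    intervalIntegral.integral_const_mul, intervalIntegral.integral_const_mul] at e2
  have h5 := mul_le_mul_of_nonneg_left (hp W u h hu) (show 0 ≤ 1 / (ν * lo) by positivity)
  have h6 : 1 / (ν * lo) * (C * (nsq m (deriv u) + diss m W u * (1 + energy (m + 1) W u)))
      = C / (ν * lo) * (nsq m (deriv u) + diss m W u * (1 + energy (m + 1) W u)) := by ring
  rw [h6] at h5
  have h7 : nsq (m + 2) W = ∫ x in (0:ℝ)..1, deriv^[m + 2] W x ^ 2 := rfl
  have h8 : l2 G = ∫ x in (0:ℝ)..1, G x ^ 2 := rfl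
  rw [e1, h7]
  rw [h8] at h5
  linarith

/-- Energy estimate for the effective velocity. -/
lemma exists_veff_energy_le {a γ ν : ℝ} (ha : 0 < a) (hγ : 0 < γ) (hν : 0 < ν) {m : ℕ}
    (hm : 1 ≤ m) {lo hi M : ℝ} (hlo : 0 < lo) (hlohi : lo ≤ hi) (hM : 0 ≤ M) :
    ∃ c C : ℝ, 0 < c ∧ 0 < C ∧ ∀ W u : ℝ → ℝ, Slice lo hi W u → HSq (m - 1) (deriv u) ≤ M →
      2 * ∫ x in (0:ℝ)..1, deriv^[m] (veff ν W u) x * deriv^[m] (dtV a γ ν W u) x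
        ≤ -c * nsq m (veff ν W u) + C * (diss m W u * (1 + energy (m + 1) W u)) := by
  obtain ⟨C, hC, hp⟩ := exists_dtV_remainder_le a γ hν m (hi := hi) hlo hM
  set q : ℝ := min (lo ^ (-γ)) (hi ^ (-γ)) with hq
  have hq0 : 0 < q := lt_min (Real.rpow_pos_of_pos hlo _)
    (Real.rpow_pos_of_pos (hlo.trans_le hlohi) _)
  set b : ℝ := a * γ / ν * q with hb
  have hb0 : 0 < b := by positivity
  refine ⟨b, 1 / (2 * b) * (2 + 2 * ν ^ 2) + 2 / b * C, hb0, by positivity, fun W u h hu => ?_⟩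
  have hpos : ∀ x, 0 < u x := fun x => hlo.trans_le (h.lo_le x)
  have hT := h.hW.dtV h.hu hpos a γ ν
  have hV := h.hW.veff h.hu ν
  have hQ := h.hu.rpow hpos (-γ)
  set E := energy (m + 1) W u with hE
  set D := diss m W u with hD
  have hE0 : 0 ≤ E := energy_nonneg _ _ _
  have hD0 : 0 ≤ D := diss_nonneg _ _ _
  set p : ℝ → ℝ := deriv^[m] (veff ν W u) with hpdef
  have hps : SmoothPer p := hV.iter m
  have hdp : deriv p = deriv^[m + 1] (veff ν W u) := by
    rw [Function.iterate_succ_apply']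
  set H : ℝ → ℝ := fun x => deriv^[m] (dtV a γ ν W u) x + (W x * deriv^[m + 1] (veff ν W u) x
          + a * γ / ν * (u x ^ (-γ) * p x)) with hH
  have c1 := (hT.iter m).continuous
  have c2 := (hV.iter (m + 1)).continuous
  have c3 := hps.continuous
  have c4 := hQ.continuous
  have c5 := h.hW.continuous
  have c6 := h.hW.deriv.continuous
  have c7 := hps.deriv.continuous
  have hHc : Continuous H := by fun_prop
  have hWx : ∀ x, deriv W x ^ 2 ≤ D := fun x =>
    (h.sq_iter_le 1 x).trans ((nsq_le_HSq (by omega) W).trans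
      (le_add_of_nonneg_right (HSq_nonneg _ _)))
  have hVE : nsq m (veff ν W u) ≤ (2 + 2 * ν ^ 2) * E := by
    have h1 := HSq_veff_le h.hW h.hu ν m
    have h2 : HSq m W ≤ E :=
      (HSq_mono (Nat.le_succ m) W).trans (le_add_of_nonneg_right (HSq_nonneg _ _))
    have h3 : HSq m (deriv u) ≤ E := le_add_of_nonneg_left (HSq_nonneg _ _)
    have h4 := nsq_le_HSq (le_refl m) (veff ν W u)
    nlinarith [mul_le_mul_of_nonneg_left h3 (sq_nonneg ν)]
  have hIBP : ∫ x in (0:ℝ)..1, (deriv W x * p x ^ 2 + 2 * (W x * (p x * deriv p x))) = 0 := by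
    have h1 := (h.hW.mul (hps.mul hps)).integral_deriv
    rw [← h1]
    congr 1; ext x
    rw [((h.hW.hasDerivAt x).fun_mul ((hps.hasDerivAt x).fun_mul (hps.hasDerivAt x))).deriv]
    ring
  have e2 : ∫ x in (0:ℝ)..1, 2 * (p x * deriv^[m] (dtV a γ ν W u) x)
      ≤ ∫ x in (0:ℝ)..1, (-(deriv W x * p x ^ 2 + 2 * (W x * (p x * deriv p x)))
        + (deriv W x * p x ^ 2 + 2 * (p x * deriv^[m] (dtV a γ ν W u) x)
          + 2 * (W x * (p x * deriv p x)))) :=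
    integral_le (by fun_prop) (by fun_prop) fun x => by linarith
  have e3 : ∫ x in (0:ℝ)..1, (deriv W x * p x ^ 2 + 2 * (p x * deriv^[m] (dtV a γ ν W u) x)
          + 2 * (W x * (p x * deriv p x)))
      ≤ ∫ x in (0:ℝ)..1, ((-b + 1 / (2 * b) * D) * p x ^ 2 + 2 / b * H x ^ 2) := by
    refine integral_le (by fun_prop) (by fun_prop) fun x => ?_
    have e4 : deriv^[m] (dtV a γ ν W u) x
        = -(W x * deriv p x) - a * γ / ν * (u x ^ (-γ) * p x) + H x := by
      simp only [hH, hdp]; ring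
    rw [e4]
    have h1 : b * p x ^ 2 ≤ a * γ / ν * u x ^ (-γ) * p x ^ 2 :=
      mul_le_mul_of_nonneg_right (mul_le_mul_of_nonneg_left
        (min_le_rpow hlo (h.lo_le x) (h.le_hi x) _) (by positivity)) (sq_nonneg _)
    have h2 : deriv W x ≤ b / 2 + 1 / (2 * b) * D := by
      have h3 : 0 ≤ 1 / (2 * b) * (b - deriv W x) ^ 2 := by positivity
      have h4 : 1 / (2 * b) * (b - deriv W x) ^ 2
          = b / 2 - deriv W x + 1 / (2 * b) * deriv W x ^ 2 := by field_simp; ring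
      have h5 := mul_le_mul_of_nonneg_left (hWx x) (show 0 ≤ 1 / (2 * b) by positivity)
      linarith
    have h3 := mul_le_mul_of_nonneg_right h2 (sq_nonneg (p x))
    have h4 : 0 ≤ 2 / b * (b / 2 * p x - H x) ^ 2 := by positivity
    have h5 : 2 / b * (b / 2 * p x - H x) ^ 2
        = b / 2 * p x ^ 2 - 2 * (p x * H x) + 2 / b * H x ^ 2 := by field_simp; ring
    linarith
  rw [intervalIntegral.integral_const_mul, integral_add' (by fun_prop) (by fun_prop),
    intervalIntegral.integral_neg, hIBP] at e2
  rw [integral_add' (f := fun x => (-b + 1 / (2 * b) * D) * p x ^ 2) (by fun_prop) (by fun_prop),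
    intervalIntegral.integral_const_mul, intervalIntegral.integral_const_mul] at e3
  have h7 : nsq m (veff ν W u) = ∫ x in (0:ℝ)..1, p x ^ 2 := rfl
  have h8 : l2 H = ∫ x in (0:ℝ)..1, H x ^ 2 := rfl
  have h5 := mul_le_mul_of_nonneg_left (hp W u h hu) (show 0 ≤ 2 / b by positivity)
  have h6 := mul_le_mul_of_nonneg_left hVE (show 0 ≤ 1 / (2 * b) * D by positivity)
  have h9 : 0 ≤ 1 / (2 * b) * (2 + 2 * ν ^ 2) * D := by positivity
  rw [← h7, ← h8] at e3
  change 2 / b * l2 H ≤ _ at h5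
  linarith

/-! ### Functions of time and space -/

/-- Smooth functions of `(t, x)` that are `1`-periodic in `x`. -/
structure SmoothSP (f : ℝ → ℝ → ℝ) : Prop where
  smooth : ContDiff ℝ ∞ (Function.uncurry f)
  per : ∀ t x, f t (x + 1) = f t x

/-- Space derivative. -/
noncomputable def Dx (f : ℝ → ℝ → ℝ) : ℝ → ℝ → ℝ := fun t => deriv (f t)

/-- Time derivative. -/
noncomputable def Dt (f : ℝ → ℝ → ℝ) : ℝ → ℝ → ℝ := fun t x => deriv (fun s => f s x) t

lemma Dx_iter (f : ℝ → ℝ → ℝ) (k : ℕ) (t : ℝ) : (Dx^[k] f) t = deriv^[k] (f t) := by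
  induction k with
  | zero => rfl
  | succ k ih => rw [Function.iterate_succ_apply', Function.iterate_succ_apply', ← ih]; rfl

namespace SmoothSP

variable {f g : ℝ → ℝ → ℝ}

lemma hasFDerivAt (hf : SmoothSP f) (p : ℝ × ℝ) :
    HasFDerivAt (Function.uncurry f) (fderiv ℝ (Function.uncurry f) p) p :=
  (hf.smooth.differentiable (by simp) p).hasFDerivAt

lemma hasDerivAt_x (hf : SmoothSP f) (t x : ℝ) :
    HasDerivAt (f t) (fderiv ℝ (Function.uncurry f) (t, x) (0, 1)) x := by
  have h1 : HasDerivAt (fun y : ℝ => (t, y)) ((0 : ℝ), (1 : ℝ)) x :=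
    (hasDerivAt_const x t).prodMk (hasDerivAt_id x)
  exact (hf.hasFDerivAt (t, x)).comp_hasDerivAt x h1

lemma hasDerivAt_t (hf : SmoothSP f) (t x : ℝ) :
    HasDerivAt (fun s => f s x) (fderiv ℝ (Function.uncurry f) (t, x) (1, 0)) t := by
  have h1 : HasDerivAt (fun s : ℝ => (s, x)) ((1 : ℝ), (0 : ℝ)) t :=
    (hasDerivAt_id t).prodMk (hasDerivAt_const t x)
  exact (hf.hasFDerivAt (t, x)).comp_hasDerivAt t h1

lemma Dx_eq (hf : SmoothSP f) (t x : ℝ) :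
    Dx f t x = fderiv ℝ (Function.uncurry f) (t, x) (0, 1) := (hf.hasDerivAt_x t x).deriv

lemma Dt_eq (hf : SmoothSP f) (t x : ℝ) :
    Dt f t x = fderiv ℝ (Function.uncurry f) (t, x) (1, 0) := (hf.hasDerivAt_t t x).deriv

lemma hasDerivAt_Dt (hf : SmoothSP f) (t x : ℝ) :
    HasDerivAt (fun s => f s x) (Dt f t x) t := by
  rw [hf.Dt_eq]; exact hf.hasDerivAt_t t x

lemma fderiv_apply_smooth (hf : SmoothSP f) (v : ℝ × ℝ) :
    ContDiff ℝ ∞ fun p => fderiv ℝ (Function.uncurry f) p v :=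
  (hf.smooth.fderiv_right (by simp)).clm_apply contDiff_const

lemma slice (hf : SmoothSP f) (t : ℝ) : SmoothPer (f t) where
  smooth := hf.smooth.comp (contDiff_const.prodMk contDiff_id)
  per := hf.per t

lemma dx (hf : SmoothSP f) : SmoothSP (Dx f) where
  smooth := by
    have : Function.uncurry (Dx f) = fun p => fderiv ℝ (Function.uncurry f) p (0, 1) := by
      ext ⟨t, x⟩; exact hf.Dx_eq t x
    rw [this]; exact hf.fderiv_apply_smooth _
  per t := (hf.slice t).deriv.per

lemma dt (hf : SmoothSP f) : SmoothSP (Dt f) where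
  smooth := by
    have : Function.uncurry (Dt f) = fun p => fderiv ℝ (Function.uncurry f) p (1, 0) := by
      ext ⟨t, x⟩; exact hf.Dt_eq t x
    rw [this]; exact hf.fderiv_apply_smooth _
  per t x := by simp only [Dt, hf.per]

lemma dx_iter (hf : SmoothSP f) (k : ℕ) : SmoothSP (Dx^[k] f) := by
  induction k with
  | zero => exact hf
  | succ k ih => rw [Function.iterate_succ_apply']; exact ih.dx

lemma Dt_Dx (hf : SmoothSP f) : Dt (Dx f) = Dx (Dt f) := by
  ext t x
  have hd : ∀ v : ℝ × ℝ, HasFDerivAt (fun p => fderiv ℝ (Function.uncurry f) p v)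
      ((ContinuousLinearMap.apply ℝ ℝ v).comp
        (fderiv ℝ (fderiv ℝ (Function.uncurry f)) (t, x))) (t, x) := fun v =>
    (ContinuousLinearMap.apply ℝ ℝ v).hasFDerivAt.comp (t, x)
      (((hf.smooth.fderiv_right (m := ∞) (by simp)).differentiable (by simp) _).hasFDerivAt)
  have e1 : Function.uncurry (Dx f) = fun p => fderiv ℝ (Function.uncurry f) p (0, 1) := by
    ext ⟨t, x⟩; exact hf.Dx_eq t x
  have e2 : Function.uncurry (Dt f) = fun p => fderiv ℝ (Function.uncurry f) p (1, 0) := by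
    ext ⟨t, x⟩; exact hf.Dt_eq t x
  rw [hf.dx.Dt_eq, hf.dt.Dx_eq, e1, e2, (hd _).fderiv, (hd _).fderiv]
  have hs : IsSymmSndFDerivAt ℝ (Function.uncurry f) (t, x) :=
    hf.smooth.contDiffAt.isSymmSndFDerivAt (by
      simp only [minSmoothness_of_isRCLikeNormedField]; exact WithTop.coe_le_coe.2 (le_top : (2 : ℕ∞) ≤ ⊤))
  exact hs _ _

lemma Dt_Dx_iter (hf : SmoothSP f) (k : ℕ) : Dt (Dx^[k] f) = Dx^[k] (Dt f) := by
  induction k with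
  | zero => rfl
  | succ k ih =>
    rw [Function.iterate_succ_apply', Function.iterate_succ_apply', (hf.dx_iter k).Dt_Dx, ih]

lemma const (c : ℝ) : SmoothSP fun _ _ => c := ⟨contDiff_const, fun _ _ => rfl⟩

lemma add (hf : SmoothSP f) (hg : SmoothSP g) : SmoothSP fun t x => f t x + g t x :=
  ⟨hf.smooth.add hg.smooth, fun t x => by simp [hf.per, hg.per]⟩

lemma sub (hf : SmoothSP f) (hg : SmoothSP g) : SmoothSP fun t x => f t x - g t x :=
  ⟨hf.smooth.sub hg.smooth, fun t x => by simp [hf.per, hg.per]⟩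

lemma neg (hf : SmoothSP f) : SmoothSP fun t x => - f t x :=
  ⟨hf.smooth.neg, fun t x => by simp [hf.per]⟩

lemma mul (hf : SmoothSP f) (hg : SmoothSP g) : SmoothSP fun t x => f t x * g t x :=
  ⟨hf.smooth.mul hg.smooth, fun t x => by simp [hf.per, hg.per]⟩

lemma const_mul (c : ℝ) (hf : SmoothSP f) : SmoothSP fun t x => c * f t x := (const c).mul hf

lemma rpow (hf : SmoothSP f) (hpos : ∀ t x, 0 < f t x) (s : ℝ) :
    SmoothSP fun t x => f t x ^ s :=
  ⟨hf.smooth.rpow_const_of_ne fun p => (hpos p.1 p.2).ne', fun t x => by simp [hf.per]⟩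

lemma comp_pos (hf : SmoothSP f) (hpos : ∀ t x, 0 < f t x) {P : ℝ → ℝ}
    (hP : ∀ z, 0 < z → ContDiffAt ℝ ∞ P z) : SmoothSP fun t x => P (f t x) where
  smooth := contDiff_iff_contDiffAt.2 fun p =>
    (hP _ (hpos p.1 p.2)).comp p hf.smooth.contDiffAt
  per t x := by simp [hf.per]

lemma continuous_slice (hf : SmoothSP f) (t : ℝ) : Continuous (f t) := (hf.slice t).continuous

/-- Differentiation under the integral sign. -/
lemma hasDerivAt_integral (hf : SmoothSP f) (t : ℝ) :
    HasDerivAt (fun s => ∫ x in (0:ℝ)..1, f s x) (∫ x in (0:ℝ)..1, Dt f t x) t := by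
  obtain ⟨K, hK⟩ := (isCompact_Icc.prod isCompact_Icc :
    IsCompact (Set.Icc (t - 1) (t + 1) ×ˢ Set.Icc (0:ℝ) 1)).exists_bound_of_continuousOn
    hf.dt.smooth.continuous.continuousOn
  refine (intervalIntegral.hasDerivAt_integral_of_dominated_loc_of_deriv_le
    (F := f) (F' := Dt f) (bound := fun _ => K)
    (Icc_mem_nhds (by linarith : t - 1 < t) (by linarith : t < t + 1)) ?_ ?_ ?_ ?_ ?_ ?_).2
  · exact Filter.Eventually.of_forall fun s => (hf.continuous_slice s).aestronglyMeasurable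
  · exact (hf.continuous_slice t).intervalIntegrable _ _
  · exact (hf.dt.continuous_slice t).aestronglyMeasurable
  · refine Filter.Eventually.of_forall fun x hx s hs => hK (s, x) ⟨hs, ?_⟩
    rw [Set.uIoc_of_le zero_le_one] at hx
    exact Set.Ioc_subset_Icc_self hx
  · simp
  · exact Filter.Eventually.of_forall fun x _ s _ => hf.hasDerivAt_Dt s x

lemma hasDerivAt_nsq (hf : SmoothSP f) (k : ℕ) (t : ℝ) :
    HasDerivAt (fun s => nsq k (f s))
      (2 * ∫ x in (0:ℝ)..1, deriv^[k] (f t) x * deriv^[k] (Dt f t) x) t := by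
  have h := ((hf.dx_iter k).mul (hf.dx_iter k)).hasDerivAt_integral t
  have e1 : (fun s => nsq k (f s))
      = fun s => ∫ x in (0:ℝ)..1, (Dx^[k] f) s x * (Dx^[k] f) s x := by
    ext s
    simp only [nsq, l2, Dx_iter, sq]
  rw [e1, ← intervalIntegral.integral_const_mul]
  refine h.congr_deriv (intervalIntegral.integral_congr fun x _ => ?_)
  have h2 := ((hf.dx_iter k).hasDerivAt_Dt t x).fun_mul ((hf.dx_iter k).hasDerivAt_Dt t x)
  have h3 : Dt (fun t x => (Dx^[k] f) t x * (Dx^[k] f) t x) t x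
      = 2 * (deriv^[k] (f t) x * deriv^[k] (Dt f t) x) := by
    rw [Dt, h2.deriv, hf.Dt_Dx_iter, Dx_iter, Dx_iter]
    ring
  exact h3

end SmoothSP

/-- Functions that agree for nonnegative times have the same time derivative there. -/
lemma deriv_eq_of_eqOn_nonneg {f g : ℝ → ℝ} {t : ℝ} (ht : 0 ≤ t)
    (hf : DifferentiableAt ℝ f t) (hg : DifferentiableAt ℝ g t) (h : ∀ s, 0 ≤ s → f s = g s) :
    deriv f t = deriv g t := by
  have hu : UniqueDiffWithinAt ℝ (Set.Ici (0:ℝ)) t := uniqueDiffOn_Ici 0 t ht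
  rw [← hf.derivWithin hu, ← hg.derivWithin hu]
  exact derivWithin_congr (fun s hs => h s hs) (h t ht)

lemma SmoothSP.Dt_congr {f g : ℝ → ℝ → ℝ} (hf : SmoothSP f) (hg : SmoothSP g)
    (h : ∀ t, 0 ≤ t → f t = g t) {t : ℝ} (ht : 0 ≤ t) : Dt f t = Dt g t := by
  ext x
  exact deriv_eq_of_eqOn_nonneg ht (hf.hasDerivAt_Dt t x).differentiableAt
    (hg.hasDerivAt_Dt t x).differentiableAt fun s hs => congrFun (h s hs) x

/-! ### Solutions with globally positive density -/

/-- A solution of the system on `[0, ∞)` whose density is extended to negative times as a positive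
function. -/
structure Sol (a γ ν : ℝ) (η w : ℝ → ℝ → ℝ) : Prop where
  hη : SmoothSP η
  hw : SmoothSP w
  pos : ∀ t x, 0 < η t x
  mass : ∀ t x, 0 ≤ t → Dt η t x + deriv (fun y => η t y * w t y) x = 0
  mom : ∀ t x, 0 ≤ t → η t x * (Dt w t x + w t x * deriv (w t) x)
    - ν * deriv (deriv (w t)) x + deriv (fun y => a * η t y ^ γ) x = 0

/-- Specific volume. -/
noncomputable def vol (η : ℝ → ℝ → ℝ) : ℝ → ℝ → ℝ := fun t x => η t x ^ (-1 : ℝ)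

/-- Effective velocity as a function of time and space. -/
noncomputable def effv (ν : ℝ) (η w : ℝ → ℝ → ℝ) : ℝ → ℝ → ℝ := fun t => veff ν (w t) (vol η t)

lemma vol_eq (η : ℝ → ℝ → ℝ) (t x : ℝ) : vol η t x = (η t x)⁻¹ :=
  Real.rpow_neg_one _

lemma eq_vol_rpow (η : ℝ → ℝ → ℝ) (t : ℝ) : η t = fun x => vol η t x ^ (-1 : ℝ) := by
  ext x
  rw [vol_eq, Real.rpow_neg_one, inv_inv]

namespace Sol

variable {a γ ν : ℝ} {η w : ℝ → ℝ → ℝ}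

lemma smooth_vol (h : Sol a γ ν η w) : SmoothSP (vol η) := h.hη.rpow h.pos _

lemma vol_pos (h : Sol a γ ν η w) (t x : ℝ) : 0 < vol η t x := Real.rpow_pos_of_pos (h.pos t x) _

lemma smooth_effv (h : Sol a γ ν η w) : SmoothSP (effv ν η w) :=
  h.hw.sub (h.smooth_vol.dx.const_mul ν)

lemma deriv_density (h : Sol a γ ν η w) (t x : ℝ) :
    deriv (η t) x = -(η t x ^ 2 * deriv (vol η t) x) := by
  have h1 := ((h.hη.slice t).hasDerivAt x).fun_inv (h.pos t x).ne'
  have h2 : vol η t = fun x => (η t x)⁻¹ := by ext x; exact vol_eq η t x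
  have h3 := (h.pos t x).ne'
  rw [h2, h1.deriv]
  field_simp

lemma Dt_density (h : Sol a γ ν η w) {t : ℝ} (ht : 0 ≤ t) (x : ℝ) :
    Dt η t x = -(deriv (η t) x * w t x + η t x * deriv (w t) x) := by
  have h1 := h.mass t x ht
  rw [deriv_fun_mul ((h.hη.slice t).differentiable x) ((h.hw.slice t).differentiable x)] at h1
  linarith

lemma Dt_vol (h : Sol a γ ν η w) {t : ℝ} (ht : 0 ≤ t) :
    Dt (vol η) t = fun x => vol η t x * deriv (w t) x - w t x * deriv (vol η t) x := by
  ext x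
  have h1 := (h.hη.hasDerivAt_Dt t x).fun_inv (h.pos t x).ne'
  have h2 : (fun s => vol η s x) = fun s => (η s x)⁻¹ := by ext s; exact vol_eq η s x
  have h3 := (h.pos t x).ne'
  rw [Dt, h2, h1.deriv, h.Dt_density ht, h.deriv_density, vol_eq]
  field_simp
  ring

lemma Dt_velocity (h : Sol a γ ν η w) {t : ℝ} (ht : 0 ≤ t) :
    Dt w t = dtW a γ ν (w t) (vol η t) := by
  ext x
  have h1 := h.mom t x ht
  have hu := h.vol_pos t x
  have e1 : (fun y => a * η t y ^ γ) = fun y => a * vol η t y ^ (-γ) := by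
    ext y
    rw [vol, ← Real.rpow_mul (h.pos t y).le]
    simp
  have e2 : deriv (fun y => a * vol η t y ^ (-γ)) x
      = a * (-γ * (vol η t x ^ (-γ - 1) * deriv (vol η t) x)) := by
    have hd := (h.smooth_vol.slice t).deriv_rpow (h.vol_pos t) (-γ)
    rw [deriv_const_mul _ (((h.smooth_vol.slice t).rpow (h.vol_pos t) _).differentiable x), hd]
  have e3 : vol η t x ^ (-γ - 1) = vol η t x ^ (-γ) / vol η t x := by
    rw [Real.rpow_sub_one hu.ne']
  have e4 : η t x = (vol η t x)⁻¹ := by rw [vol_eq, inv_inv]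
  rw [e1, e2, e3, e4] at h1
  have h2 := hu.ne'
  field_simp at h1
  simp only [dtW]
  linarith

lemma Dt_effv (h : Sol a γ ν η w) {t : ℝ} (ht : 0 ≤ t) :
    Dt (effv ν η w) t = dtV a γ ν (w t) (vol η t) := by
  ext x
  have hu := h.smooth_vol
  have hw := h.hw.slice t
  have hut := hu.slice t
  have h1 : Dt (effv ν η w) t x = Dt w t x - ν * Dt (Dx (vol η)) t x :=
    ((h.hw.hasDerivAt_Dt t x).fun_sub ((hu.dx.hasDerivAt_Dt t x).const_mul ν)).deriv
  have h2 : Dt (Dx (vol η)) t x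
      = vol η t x * deriv (deriv (w t)) x - w t x * deriv (deriv (vol η t)) x := by
    rw [hu.Dt_Dx, Dx, h.Dt_vol ht,
      (((hut.hasDerivAt x).fun_mul (hw.deriv.hasDerivAt x)).fun_sub
        ((hw.hasDerivAt x).fun_mul (hut.deriv.hasDerivAt x))).deriv]
    ring
  have h3 : deriv (veff ν (w t) (vol η t)) x
      = deriv (w t) x - ν * deriv (deriv (vol η t)) x :=
    ((hw.hasDerivAt x).fun_sub ((hut.deriv.hasDerivAt x).const_mul ν)).deriv
  rw [h1, h2, h.Dt_velocity ht]
  simp only [dtW, dtV, h3]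
  ring

lemma hasDerivAt_nsq_velocity (h : Sol a γ ν η w) (k : ℕ) {t : ℝ} (ht : 0 ≤ t) :
    HasDerivAt (fun s => nsq k (w s))
      (2 * ∫ x in (0:ℝ)..1, deriv^[k] (w t) x * deriv^[k] (dtW a γ ν (w t) (vol η t)) x) t := by
  rw [← h.Dt_velocity ht]
  exact h.hw.hasDerivAt_nsq k t

lemma hasDerivAt_nsq_effv (h : Sol a γ ν η w) (k : ℕ) {t : ℝ} (ht : 0 ≤ t) :
    HasDerivAt (fun s => nsq k (veff ν (w s) (vol η s)))
      (2 * ∫ x in (0:ℝ)..1, deriv^[k] (veff ν (w t) (vol η t)) x *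
        deriv^[k] (dtV a γ ν (w t) (vol η t)) x) t := by
  rw [← h.Dt_effv ht]
  exact h.smooth_effv.hasDerivAt_nsq k t

/-- Mass is conserved. -/
lemma integral_density (h : Sol a γ ν η w) {t : ℝ} (ht : 0 ≤ t) :
    ∫ x in (0:ℝ)..1, η t x = ∫ x in (0:ℝ)..1, η 0 x := by
  have hd : ∀ s, HasDerivAt (fun s => ∫ x in (0:ℝ)..1, η s x) _ s := h.hη.hasDerivAt_integral
  refine constant_of_derivWithin_zero (f := fun s => ∫ x in (0:ℝ)..1, η s x) (a := 0) (b := t)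
    (fun s _ => (hd s).differentiableAt.differentiableWithinAt) (fun s hs => ?_) t ⟨ht, le_rfl⟩
  rw [(hd s).hasDerivWithinAt.derivWithin
    (uniqueDiffOn_Icc (hs.1.trans_lt hs.2) s ⟨hs.1, hs.2.le⟩)]
  have e : Dt η s = fun x => -deriv (fun y => η s y * w s y) x := by
    ext x; linarith [h.mass s x hs.1]
  rw [e, intervalIntegral.integral_neg, ((h.hη.slice s).mul (h.hw.slice s)).integral_deriv, neg_zero]

/-- Momentum is conserved. -/
lemma integral_momentum (h : Sol a γ ν η w) {t : ℝ} (ht : 0 ≤ t) :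
    ∫ x in (0:ℝ)..1, η t x * w t x = ∫ x in (0:ℝ)..1, η 0 x * w 0 x := by
  have hd : ∀ s, HasDerivAt (fun s => ∫ x in (0:ℝ)..1, η s x * w s x) _ s :=
    (h.hη.mul h.hw).hasDerivAt_integral
  refine constant_of_derivWithin_zero (f := fun s => ∫ x in (0:ℝ)..1, η s x * w s x)
    (a := 0) (b := t)
    (fun s _ => (hd s).differentiableAt.differentiableWithinAt) (fun s hs => ?_) t ⟨ht, le_rfl⟩
  rw [(hd s).hasDerivWithinAt.derivWithin
    (uniqueDiffOn_Icc (hs.1.trans_lt hs.2) s ⟨hs.1, hs.2.le⟩)]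
  have hη := h.hη.slice s
  have hw := h.hw.slice s
  set G : ℝ → ℝ := fun x => ν * deriv (w s) x - (η s x * w s x * w s x + a * η s x ^ γ) with hG
  have hGs : SmoothPer G := (hw.deriv.const_mul ν).sub
    (((hη.mul hw).mul hw).add ((hη.rpow (h.pos s) γ).const_mul a))
  have e : Dt (fun t x => η t x * w t x) s = deriv G := by
    ext x
    have e1 : Dt (fun t x => η t x * w t x) s x = Dt η s x * w s x + η s x * Dt w s x :=
      ((h.hη.hasDerivAt_Dt s x).fun_mul (h.hw.hasDerivAt_Dt s x)).deriv
    have e2 := ((hw.deriv.hasDerivAt x).const_mul ν).fun_sub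
      ((((hη.hasDerivAt x).fun_mul (hw.hasDerivAt x)).fun_mul (hw.hasDerivAt x)).fun_add
        (((hη.rpow (h.pos s) γ).const_mul a).hasDerivAt x))
    rw [e1, hG, e2.deriv, h.Dt_density hs.1]
    linarith [h.mom s x hs.1]
  rw [e, hGs.integral_deriv]

end Sol

/-! ### The basic energy -/

/-- `P` is the relative pressure potential, `h` its derivative. -/
structure Potential (a γ : ℝ) (P h : ℝ → ℝ) : Prop where
  smooth : ∀ z, 0 < z → ContDiffAt ℝ ∞ P z
  smooth' : ∀ z, 0 < z → ContDiffAt ℝ ∞ h z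
  deriv : ∀ z, 0 < z → HasDerivAt P (h z) z
  deriv' : ∀ z, 0 < z → HasDerivAt h (a * γ * z ^ (γ - 2)) z
  one : P 1 = 0
  one' : h 1 = 0

lemma exists_potential (a : ℝ) {γ : ℝ} (hγ : γ ≠ 0) : ∃ P h, Potential a γ P h := by
  rcases eq_or_ne γ 1 with rfl | h1
  · refine ⟨fun z => a * (z * Real.log z - z + 1), fun z => a * Real.log z, ⟨?_, ?_, ?_, ?_, ?_, ?_⟩⟩
    · intro z hz
      exact contDiffAt_const.mul (((contDiffAt_id.mul (Real.contDiffAt_log.2 hz.ne')).sub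
        contDiffAt_id).add contDiffAt_const)
    · intro z hz
      exact contDiffAt_const.mul (Real.contDiffAt_log.2 hz.ne')
    · intro z hz
      have h2 := ((((hasDerivAt_id z).fun_mul (Real.hasDerivAt_log hz.ne')).fun_sub
        (hasDerivAt_id z)).add_const 1).const_mul a
      refine h2.congr_deriv ?_
      have := hz.ne'
      simp only [id]
      field_simp
      ring
    · intro z hz
      refine ((Real.hasDerivAt_log hz.ne').const_mul a).congr_deriv ?_
      rw [show (1:ℝ) - 2 = -1 by norm_num, Real.rpow_neg_one]
      ring
    · simp
    · simp
  · have h1' : γ - 1 ≠ 0 := sub_ne_zero.2 h1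
    refine ⟨fun z => a / (γ - 1) * (z ^ γ - γ * z + (γ - 1)),
      fun z => a * γ / (γ - 1) * (z ^ (γ - 1) - 1), ⟨?_, ?_, ?_, ?_, ?_, ?_⟩⟩
    · intro z hz
      exact contDiffAt_const.mul (((Real.contDiffAt_rpow_const_of_ne hz.ne').sub
        (contDiffAt_const.mul contDiffAt_id)).add contDiffAt_const)
    · intro z hz
      exact contDiffAt_const.mul ((Real.contDiffAt_rpow_const_of_ne hz.ne').sub contDiffAt_const)
    · intro z hz
      have h2 := (((Real.hasDerivAt_rpow_const (x := z) (p := γ) (Or.inl hz.ne')).fun_sub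
        ((hasDerivAt_id z).const_mul γ)).add_const (γ - 1)).const_mul (a / (γ - 1))
      refine h2.congr_deriv ?_
      field_simp
    · intro z hz
      have h2 := ((Real.hasDerivAt_rpow_const (x := z) (p := γ - 1) (Or.inl hz.ne')).sub_const
        1).const_mul (a * γ / (γ - 1))
      refine h2.congr_deriv ?_
      rw [show γ - 1 - 1 = γ - 2 by ring]
      field_simp
    · simp
    · simp

lemma exists_eq_deriv_mul {f f' : ℝ → ℝ} (hf : ∀ z, 0 < z → HasDerivAt f (f' z) z)
    (h1 : f 1 = 0) {z : ℝ} (hz : 0 < z) : ∃ ξ ∈ Set.uIcc 1 z, f z = f' ξ * (z - 1) := by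
  rcases lt_trichotomy z 1 with h | rfl | h
  · obtain ⟨ξ, hξ, he⟩ := exists_hasDerivAt_eq_slope f f' h
      (fun y hy => (hf y (hz.trans_le hy.1)).continuousAt.continuousWithinAt)
      (fun y hy => hf y (hz.trans hy.1))
    refine ⟨ξ, ?_, ?_⟩
    · rw [Set.uIcc_of_ge h.le]; exact Set.Ioo_subset_Icc_self hξ
    · have : (1:ℝ) - z ≠ 0 := by linarith
      rw [he, h1]
      field_simp
      ring
  · exact ⟨1, by simp, by simp [h1]⟩
  · obtain ⟨ξ, hξ, he⟩ := exists_hasDerivAt_eq_slope f f' h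
      (fun y hy => (hf y (zero_lt_one.trans_le hy.1)).continuousAt.continuousWithinAt)
      (fun y hy => hf y (zero_lt_one.trans hy.1))
    refine ⟨ξ, ?_, ?_⟩
    · rw [Set.uIcc_of_le h.le]; exact Set.Ioo_subset_Icc_self hξ
    · have : z - 1 ≠ 0 := by linarith
      rw [he, h1]
      field_simp
      ring

lemma Potential.exists_eq {a γ : ℝ} {P h : ℝ → ℝ} (hP : Potential a γ P h) {z : ℝ}
    (hz : 0 < z) : ∃ θ ∈ Set.uIcc 1 z, ∃ ξ ∈ Set.uIcc 1 z,
      P z = a * γ * θ ^ (γ - 2) * ((ξ - 1) * (z - 1)) := by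
  obtain ⟨ξ, hξ, e1⟩ := exists_eq_deriv_mul hP.deriv hP.one hz
  have hξ0 : 0 < ξ := (lt_min zero_lt_one hz).trans_le hξ.1
  obtain ⟨θ, hθ, e2⟩ := exists_eq_deriv_mul hP.deriv' hP.one' hξ0
  refine ⟨θ, Set.uIcc_subset_uIcc_left hξ hθ, ξ, hξ, ?_⟩
  rw [e1, e2]
  ring

lemma mul_sub_one_mem {z ξ : ℝ} (hξ : ξ ∈ Set.uIcc 1 z) :
    0 ≤ (ξ - 1) * (z - 1) ∧ (ξ - 1) * (z - 1) ≤ (z - 1) ^ 2 := by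
  rcases le_total 1 z with h | h
  · rw [Set.uIcc_of_le h] at hξ
    constructor <;> nlinarith [hξ.1, hξ.2]
  · rw [Set.uIcc_of_ge h] at hξ
    constructor <;> nlinarith [hξ.1, hξ.2]

lemma Potential.nonneg {a γ : ℝ} (ha : 0 < a) (hγ : 0 < γ) {P h : ℝ → ℝ}
    (hP : Potential a γ P h) {z : ℝ} (hz : 0 < z) : 0 ≤ P z := by
  obtain ⟨θ, hθ, ξ, hξ, e⟩ := hP.exists_eq hz
  have hθ0 : 0 < θ := (lt_min zero_lt_one hz).trans_le hθ.1
  rw [e]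
  have := (mul_sub_one_mem hξ).1
  positivity

lemma Potential.le {a γ : ℝ} (ha : 0 < a) (hγ : 0 < γ) {P h : ℝ → ℝ}
    (hP : Potential a γ P h) {lo hi : ℝ} (hlo : 0 < lo) (hlo1 : lo ≤ 1) (hhi1 : 1 ≤ hi) {z : ℝ}
    (h1 : lo ≤ z) (h2 : z ≤ hi) :
    P z ≤ a * γ * (lo ^ (γ - 2) + hi ^ (γ - 2)) * (z - 1) ^ 2 := by
  have hz := hlo.trans_le h1
  obtain ⟨θ, hθ, ξ, hξ, e⟩ := hP.exists_eq hz
  have hθ1 : lo ≤ θ := (le_min hlo1 h1).trans hθ.1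
  have hθ2 : θ ≤ hi := hθ.2.trans (max_le hhi1 h2)
  rw [e]
  have h3 := mul_sub_one_mem hξ
  have h4 := rpow_le_add hlo hθ1 hθ2 (γ - 2)
  have h5 : 0 ≤ θ ^ (γ - 2) := (Real.rpow_pos_of_pos (hlo.trans_le hθ1) _).le
  have := h3.1
  gcongr
  exact h3.2

/-- Density of the basic energy. -/
noncomputable def baseDensity (ν : ℝ) (P : ℝ → ℝ) (η w : ℝ → ℝ → ℝ) : ℝ → ℝ → ℝ := fun t x =>
  1 / 2 * (η t x * (w t x * w t x)) + 1 / 2 * (η t x * (effv ν η w t x * effv ν η w t x))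
    + 2 * P (η t x)

namespace Sol

variable {a γ ν : ℝ} {η w : ℝ → ℝ → ℝ} {P h : ℝ → ℝ}

lemma smooth_baseDensity (hs : Sol a γ ν η w) (hP : Potential a γ P h) :
    SmoothSP (baseDensity ν P η w) :=
  (((hs.hη.mul (hs.hw.mul hs.hw)).const_mul (1 / 2)).add
    ((hs.hη.mul (hs.smooth_effv.mul hs.smooth_effv)).const_mul (1 / 2))).add
    ((hs.hη.comp_pos hs.pos hP.smooth).const_mul 2)

/-- Dissipation of the basic energy. -/
lemma hasDerivAt_integral_baseDensity (hs : Sol a γ ν η w) (hP : Potential a γ P h) {t : ℝ}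
    (ht : 0 ≤ t) :
    HasDerivAt (fun s => ∫ x in (0:ℝ)..1, baseDensity ν P η w s x)
      (-∫ x in (0:ℝ)..1, ν * deriv (w t) x ^ 2
        + ν * (a * γ * (η t x * vol η t x ^ (-γ) * deriv (vol η t) x ^ 2))) t := by
  refine ((hs.smooth_baseDensity hP).hasDerivAt_integral t).congr_deriv ?_
  have hη := hs.hη.slice t
  have hw := hs.hw.slice t
  have hu := hs.smooth_vol.slice t
  have hv := hs.smooth_effv.slice t
  have hh := (hs.hη.comp_pos hs.pos hP.smooth').slice t
  set G : ℝ → ℝ := fun x => ν * (w t x * deriv (w t) x)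
    - η t x * w t x * (1 / 2 * (w t x * w t x) + 1 / 2 * (effv ν η w t x * effv ν η w t x)
      + 2 * h (η t x)) with hG
  have hGs : SmoothPer G := ((hw.mul hw.deriv).const_mul ν).sub ((hη.mul hw).mul
    ((((hw.mul hw).const_mul (1 / 2)).add ((hv.mul hv).const_mul (1 / 2))).add (hh.const_mul 2)))
  have hD : SmoothPer fun x => ν * deriv (w t) x ^ 2
      + ν * (a * γ * (η t x * vol η t x ^ (-γ) * deriv (vol η t) x ^ 2)) := by
    simp only [sq]
    exact ((hw.deriv.mul hw.deriv).const_mul ν).add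
      ((((hη.mul (hu.rpow (hs.vol_pos t) _)).mul (hu.deriv.mul hu.deriv)).const_mul _).const_mul ν)
  have e : Dt (baseDensity ν P η w) t = fun x => -(ν * deriv (w t) x ^ 2
      + ν * (a * γ * (η t x * vol η t x ^ (-γ) * deriv (vol η t) x ^ 2))) + deriv G x := by
    ext x
    have hη0 := hs.pos t x
    have hN := hs.hη.hasDerivAt_Dt t x
    have hW := hs.hw.hasDerivAt_Dt t x
    have hV := hs.smooth_effv.hasDerivAt_Dt t x
    have e1 := ((((hN.fun_mul (hW.fun_mul hW)).const_mul (1 / 2)).fun_add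
      ((hN.fun_mul (hV.fun_mul hV)).const_mul (1 / 2))).fun_add
      (((hP.deriv _ hη0).comp t hN).const_mul 2)).deriv
    have dw := hw.hasDerivAt x
    have dv := hv.hasDerivAt x
    have dη := hη.hasDerivAt x
    have e2 := (((dw.fun_mul (hw.deriv.hasDerivAt x)).const_mul ν).fun_sub
      ((dη.fun_mul dw).fun_mul ((((dw.fun_mul dw).const_mul (1 / 2)).fun_add
        ((dv.fun_mul dv).const_mul (1 / 2))).fun_add
        (((hP.deriv' _ hη0).comp x dη).const_mul 2)))).deriv
    have e3 : deriv G x = _ := e2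
    have e4 : Dt (baseDensity ν P η w) t x = _ := e1
    have e5 : deriv (effv ν η w t) x = deriv (w t) x - ν * deriv (deriv (vol η t)) x :=
      (dw.fun_sub ((hu.deriv.hasDerivAt x).const_mul ν)).deriv
    have e6 : effv ν η w t x = w t x - ν * deriv (vol η t) x := rfl
    have e7 : η t x ^ (γ - 2) = vol η t x ^ (-γ) / η t x ^ 2 := by
      have : vol η t x ^ (-γ) = η t x ^ γ := by
        rw [vol, ← Real.rpow_mul hη0.le]; simp
      rw [this, Real.rpow_sub hη0]
      norm_num
    have e8 : veff ν (w t) (vol η t) = effv ν η w t := rfl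
    rw [e3, e4, hs.Dt_density ht, hs.Dt_velocity ht, hs.Dt_effv ht]
    simp only [dtW, dtV, Function.comp]
    rw [e8, e5, e7, hs.deriv_density, e6, vol_eq]
    generalize (η t x)⁻¹ ^ (-γ) = q
    have := hη0.ne'
    field_simp
    ring
  rw [e, integral_add' hD.neg.continuous hGs.deriv.continuous, hGs.integral_deriv,
    intervalIntegral.integral_neg, add_zero]

end Sol

/-- Assumptions on the initial data. -/
structure Data (r R A : ℝ) (η w : ℝ → ℝ → ℝ) : Prop where
  le : ∀ x, r ≤ η 0 x
  ge : ∀ x, η 0 x ≤ R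
  mass : ∫ x in (0:ℝ)..1, η 0 x = 1
  momentum : ∫ x in (0:ℝ)..1, η 0 x * w 0 x = 0
  bound : HSq 4 (fun x => η 0 x - 1) + HSq 4 (w 0) ≤ A

lemma le_of_deriv_nonpos {L : ℝ → ℝ} (h : ∀ t, 0 ≤ t → ∃ d, HasDerivAt L d t ∧ d ≤ 0) {t : ℝ}
    (ht : 0 ≤ t) : L t ≤ L 0 := by
  have hd : ∀ t, 0 ≤ t → DifferentiableAt ℝ L t := fun t ht =>
    let ⟨_, h1, _⟩ := h t ht; h1.differentiableAt
  refine antitoneOn_of_deriv_nonpos (convex_Ici 0)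
    (fun s hs => (hd s hs).continuousAt.continuousWithinAt)
    (fun s hs => (hd s (interior_subset hs)).differentiableWithinAt) (fun s hs => ?_)
    Set.self_mem_Ici ht ht
  obtain ⟨d, h1, h2⟩ := h s (interior_subset hs)
  rwa [h1.deriv]

lemma deriv_sub_one (f : ℝ → ℝ) : deriv (fun x => f x - 1) = deriv f := by
  ext x
  exact deriv_sub_const 1

lemma energy_zero (W u : ℝ → ℝ) : energy 0 W u = l2 W + l2 (deriv u) := by
  simp [energy, HSq_eq, nsq]

lemma diss_zero (W u : ℝ → ℝ) : diss 0 W u = l2 W + nsq 1 W + l2 (deriv u) := by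
  simp [diss, HSq_eq, nsq, Finset.sum_range_succ]

namespace Sol

variable {a γ ν r R A : ℝ} {η w : ℝ → ℝ → ℝ} {P h : ℝ → ℝ}

lemma baseDensity_le (ha : 0 < a) (hγ : 0 < γ) (hs : Sol a γ ν η w)
    (hP : Potential a γ P h) {lo hi : ℝ} (hlo : 0 < lo) (hlo1 : lo ≤ 1) (hhi1 : 1 ≤ hi) {t : ℝ}
    (h1 : ∀ x, lo ≤ η t x) (h2 : ∀ x, η t x ≤ hi) :
    ∫ x in (0:ℝ)..1, baseDensity ν P η w t x
      ≤ (3 / 2 * hi + hi * ν ^ 2 + 2 * (a * γ * (lo ^ (γ - 2) + hi ^ (γ - 2))))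
        * (energy 0 (w t) (vol η t) + l2 fun x => η t x - 1) := by
  set c := a * γ * (lo ^ (γ - 2) + hi ^ (γ - 2)) with hc
  have hc0 : 0 ≤ c := by have := zero_lt_one.trans_le hhi1; positivity
  have hw := (hs.hw.slice t).sq_continuous
  have hu := (hs.smooth_vol.slice t).deriv.sq_continuous
  have hwu : Continuous fun x => w t x ^ 2 + deriv (vol η t) x ^ 2 := hw.add hu
  have hη := ((hs.hη.slice t).sub (SmoothPer.const 1)).sq_continuous
  rw [energy_zero, l2, l2, l2, ← integral_add' hw hu, ← integral_add' hwu hη,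
    ← intervalIntegral.integral_const_mul]
  refine integral_le ((hs.smooth_baseDensity hP).slice t).continuous (by fun_prop) fun x => ?_
  have h3 := hP.le ha hγ hlo hlo1 hhi1 (h1 x) (h2 x)
  have h4 : effv ν η w t x = w t x - ν * deriv (vol η t) x := rfl
  have h5 : effv ν η w t x * effv ν η w t x
      ≤ 2 * w t x ^ 2 + 2 * ν ^ 2 * deriv (vol η t) x ^ 2 := by
    rw [h4]; nlinarith [sq_nonneg (w t x + ν * deriv (vol η t) x)]
  have h6 := hs.pos t x
  have h7 : η t x * (effv ν η w t x * effv ν η w t x)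
      ≤ hi * (2 * w t x ^ 2 + 2 * ν ^ 2 * deriv (vol η t) x ^ 2) :=
    mul_le_mul (h2 x) h5 (mul_self_nonneg _) (by linarith)
  have h8 : η t x * (w t x * w t x) ≤ hi * w t x ^ 2 := by
    rw [← sq]; exact mul_le_mul_of_nonneg_right (h2 x) (sq_nonneg _)
  have hhi : 0 ≤ hi := by linarith
  simp only [baseDensity]
  have q1 : 0 ≤ hi * ν ^ 2 * w t x ^ 2 := by positivity
  have q2 : 0 ≤ 2 * c * w t x ^ 2 := by positivity
  have q3 : 0 ≤ 3 / 2 * hi * deriv (vol η t) x ^ 2 := by positivity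
  have q4 : 0 ≤ 2 * c * deriv (vol η t) x ^ 2 := by positivity
  have q5 : 0 ≤ (3 / 2 * hi + hi * ν ^ 2) * (η t x - 1) ^ 2 := by positivity
  nlinarith

lemma integral_mul_sq_le (ha : 0 < a) (hγ : 0 < γ) (hs : Sol a γ ν η w)
    (hP : Potential a γ P h) (t : ℝ) :
    ν ^ 2 / 4 * ∫ x in (0:ℝ)..1, η t x * deriv (vol η t) x ^ 2
      ≤ ∫ x in (0:ℝ)..1, baseDensity ν P η w t x := by
  have hη := (hs.hη.slice t).continuous
  have hu := (hs.smooth_vol.slice t).deriv.continuous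
  rw [← intervalIntegral.integral_const_mul]
  refine integral_le (by fun_prop) ((hs.smooth_baseDensity hP).slice t).continuous fun x => ?_
  have h3 := hP.nonneg ha hγ (hs.pos t x)
  have h4 : effv ν η w t x = w t x - ν * deriv (vol η t) x := rfl
  have h6 := hs.pos t x
  have h5 : ν ^ 2 * deriv (vol η t) x ^ 2
      ≤ 2 * (w t x * w t x) + 2 * (effv ν η w t x * effv ν η w t x) := by
    rw [h4]; nlinarith [sq_nonneg (w t x + (w t x - ν * deriv (vol η t) x))]
  simp only [baseDensity]
  nlinarith [mul_le_mul_of_nonneg_left h5 h6.le]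

lemma energy_zero_le (ha : 0 < a) (hγ : 0 < γ) (hν : 0 < ν) (hs : Sol a γ ν η w)
    (hP : Potential a γ P h) {lo : ℝ} (hlo : 0 < lo) {t : ℝ} (h1 : ∀ x, lo ≤ η t x) :
    energy 0 (w t) (vol η t)
      ≤ 2 / lo * (1 + 2 / ν ^ 2) * ∫ x in (0:ℝ)..1, baseDensity ν P η w t x := by
  have hw := (hs.hw.slice t).sq_continuous
  have hu := (hs.smooth_vol.slice t).deriv.sq_continuous
  rw [energy_zero, l2, l2, ← integral_add' hw hu, ← intervalIntegral.integral_const_mul]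
  have hb := ((hs.smooth_baseDensity hP).slice t).continuous
  refine integral_le (by fun_prop) (by fun_prop) fun x => ?_
  have h3 := hP.nonneg ha hγ (hs.pos t x)
  have h4 : effv ν η w t x = w t x - ν * deriv (vol η t) x := rfl
  set v := effv ν η w t x with hv
  have h5 : deriv (vol η t) x ^ 2 ≤ 2 / ν ^ 2 * (w t x * w t x + v * v) := by
    rw [div_mul_eq_mul_div, le_div_iff₀ (by positivity), h4]
    nlinarith [sq_nonneg (w t x + (w t x - ν * deriv (vol η t) x))]
  have h6 : lo / 2 * (w t x * w t x + v * v) ≤ baseDensity ν P η w t x := by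
    simp only [baseDensity, ← hv]
    nlinarith [mul_le_mul_of_nonneg_right (h1 x)
      (add_nonneg (mul_self_nonneg (w t x)) (mul_self_nonneg v))]
  calc w t x ^ 2 + deriv (vol η t) x ^ 2
      ≤ (1 + 2 / ν ^ 2) * (w t x * w t x + v * v) := by
        nlinarith [mul_self_nonneg v]
    _ = 2 / lo * (1 + 2 / ν ^ 2) * (lo / 2 * (w t x * w t x + v * v)) := by
        field_simp
    _ ≤ _ := mul_le_mul_of_nonneg_left h6 (by positivity)

lemma baseDensity_antitone (ha : 0 < a) (hγ : 0 < γ) (hν : 0 < ν) (hs : Sol a γ ν η w)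
    (hP : Potential a γ P h) {t : ℝ} (ht : 0 ≤ t) :
    ∫ x in (0:ℝ)..1, baseDensity ν P η w t x ≤ ∫ x in (0:ℝ)..1, baseDensity ν P η w 0 x := by
  refine le_of_deriv_nonpos (L := fun t => ∫ x in (0:ℝ)..1, baseDensity ν P η w t x)
    (fun t ht => ⟨_, hs.hasDerivAt_integral_baseDensity hP ht, ?_⟩) ht
  rw [neg_nonpos]
  refine intervalIntegral.integral_nonneg zero_le_one fun x _ => ?_
  have := hs.pos t x
  have := hs.vol_pos t x
  positivity

lemma exists_density_eq_one (hs : Sol a γ ν η w) (hd : Data r R A η w) {t : ℝ} (ht : 0 ≤ t) :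
    ∃ y ∈ Set.Icc (0:ℝ) 1, η t y = 1 := by
  have h := hs.integral_density ht
  have hc := (hs.hη.slice t).continuous
  obtain ⟨y, hy, h0⟩ := exists_zero_of_integral_eq_zero (f := fun x => η t x - 1) (by fun_prop) (by
    rw [intervalIntegral.integral_sub (hc.intervalIntegrable _ _) (by simp), h, hd.mass]
    simp)
  exact ⟨y, hy, by linarith⟩

lemma exists_velocity_eq_zero (hs : Sol a γ ν η w) (hd : Data r R A η w) {t : ℝ} (ht : 0 ≤ t) :
    ∃ y ∈ Set.Icc (0:ℝ) 1, w t y = 0 := by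
  obtain ⟨y, hy, h0⟩ := exists_zero_of_integral_eq_zero
    ((hs.hη.mul hs.hw).slice t).continuous ((hs.integral_momentum ht).trans hd.momentum)
  exact ⟨y, hy, (mul_eq_zero.1 h0).resolve_left (hs.pos t y).ne'⟩

lemma abs_log_density_le (hs : Sol a γ ν η w) (hd : Data r R A η w) {t : ℝ} (ht : 0 ≤ t) (x : ℝ) :
    |Real.log (η t x)|
      ≤ 1 / 2 * ((∫ x in (0:ℝ)..1, η t x * deriv (vol η t) x ^ 2) + 1) := by
  have hη := hs.hη.slice t
  have hu := (hs.smooth_vol.slice t).deriv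
  have hl : SmoothPer fun x => Real.log (η t x) :=
    (hs.hη.comp_pos hs.pos fun z hz => Real.contDiffAt_log.2 hz.ne').slice t
  obtain ⟨y, hy, hy1⟩ := hs.exists_density_eq_one hd ht
  obtain ⟨z, hz, hzx⟩ := hl.exists_eq x
  have h1 := hl.abs_sub_le hz hy
  rw [hy1, Real.log_one, sub_zero, hzx] at h1
  refine h1.trans ?_
  have e : ∫ x in (0:ℝ)..1, η t x = 1 := (hs.integral_density ht).trans hd.mass
  have hc : Continuous fun x => η t x * deriv (vol η t) x ^ 2 := hη.continuous.mul hu.sq_continuous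
  rw [show (1:ℝ) / 2 * ((∫ x in (0:ℝ)..1, η t x * deriv (vol η t) x ^ 2) + 1)
    = 1 / 2 * ((∫ x in (0:ℝ)..1, η t x * deriv (vol η t) x ^ 2) + ∫ x in (0:ℝ)..1, η t x) by rw [e],
    ← integral_add' hc hη.continuous, ← intervalIntegral.integral_const_mul]
  refine integral_le hl.deriv.continuous.abs ((hc.add hη.continuous).const_mul _) fun x => ?_
  have hp := hs.pos t x
  have h2 : deriv (fun x => Real.log (η t x)) x = -(η t x * deriv (vol η t) x) := by
    rw [((hη.hasDerivAt x).log hp.ne').deriv, hs.deriv_density]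
    field_simp
  rw [h2, abs_neg, abs_mul, abs_of_pos hp]
  nlinarith [mul_nonneg hp.le (sq_nonneg (|deriv (vol η t) x| - 1)), sq_abs (deriv (vol η t) x)]

end Sol

/-- `L` is a Lyapunov functional of order `k` along the solution. -/
structure Lyap (c C : ℝ) (k : ℕ) (η w : ℝ → ℝ → ℝ) (L : ℝ → ℝ) : Prop where
  deriv : ∀ t, 0 ≤ t → ∃ d, HasDerivAt L d t ∧ d ≤ -c * diss k (w t) (vol η t)
  lower : ∀ t, 0 ≤ t → energy k (w t) (vol η t) ≤ C * L t
  upper : ∀ t, 0 ≤ t → L t ≤ C * energy k (w t) (vol η t)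

lemma exists_initial_energy_le {r R A : ℝ} (hr : 0 < r) (hA : 0 ≤ A) {m : ℕ} (hm : m ≤ 4) :
    ∃ C : ℝ, 0 < C ∧ ∀ a γ ν (η w : ℝ → ℝ → ℝ), Sol a γ ν η w → Data r R A η w →
      energy (m + 1) (w 0) (vol η 0)
        ≤ C * (HSq (m + 1) (fun x => η 0 x - 1) + HSq (m + 1) (w 0)) := by
  obtain ⟨C, hC, hp⟩ := exists_HSq_deriv_rpow_le m (hi := R) hr
    (by positivity : 0 ≤ R ^ 2 + A) (-1)
  refine ⟨C + 1, by positivity, fun a γ ν η w hs hd => ?_⟩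
  have hη := hs.hη.slice 0
  have e : HSq m (deriv (η 0)) ≤ HSq (m + 1) (fun x => η 0 x - 1) := by
    rw [← deriv_sub_one]; exact HSq_deriv_le _ _
  have h1 : HSq m (η 0) ≤ R ^ 2 + A := by
    refine (HSq_mono hm _).trans ?_
    rw [HSq_succ, ← deriv_sub_one]
    refine add_le_add (l2_le_of_sq_le hη.continuous fun x =>
      pow_le_pow_left₀ (hs.pos 0 x).le (hd.ge x) 2) ((HSq_deriv_le 3 _).trans ?_)
    linarith [hd.bound, HSq_nonneg 4 (w 0)]
  have h2 := hp _ hη hd.le hd.ge h1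
  have h3 := HSq_nonneg (m + 1) (fun x => η 0 x - 1)
  have h4 := HSq_nonneg (m + 1) (w 0)
  have h5 : HSq m (deriv (vol η 0)) ≤ C * HSq m (deriv (η 0)) := h2
  rw [energy, Nat.add_sub_cancel]
  nlinarith

/-- Uniform density bounds. -/
lemma exists_density_bounds {a γ ν r R A : ℝ} (ha : 0 < a) (hγ : 0 < γ) (hν : 0 < ν)
    (hr : 0 < r) (hA : 0 ≤ A) :
    ∃ B : ℝ, 0 < B ∧ ∀ η w : ℝ → ℝ → ℝ, Sol a γ ν η w → Data r R A η w →
      ∀ t, 0 ≤ t → ∀ x, Real.exp (-B) ≤ η t x ∧ η t x ≤ Real.exp B := by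
  obtain ⟨P, h, hP⟩ := exists_potential a hγ.ne'
  obtain ⟨C1, hC1, h1⟩ := exists_initial_energy_le (R := R) hr hA (m := 3) (by norm_num)
  obtain ⟨K0, hK0, hK0'⟩ : ∃ K, K = 3 / 2 * max R 1 + max R 1 * ν ^ 2
    + 2 * (a * γ * (min r 1 ^ (γ - 2) + max R 1 ^ (γ - 2))) ∧ 0 < K := by
    have hr1 : 0 < min r 1 := lt_min hr one_pos
    have hR1 : 0 < max R 1 := lt_max_of_lt_right one_pos
    exact ⟨_, rfl, by positivity⟩
  refine ⟨1 / 2 * (4 / ν ^ 2 * (K0 * (C1 * A + A)) + 1), by positivity, fun η w hs hd t ht x => ?_⟩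
  have hF0 : ∫ x in (0:ℝ)..1, baseDensity ν P η w 0 x ≤ K0 * (C1 * A + A) := by
    refine (hs.baseDensity_le ha hγ hP (lt_min hr one_pos) (min_le_right _ _) (le_max_right _ _)
      (fun x => (min_le_left _ _).trans (hd.le x))
      fun x => (hd.ge x).trans (le_max_left _ _)).trans ?_
    rw [← hK0]
    refine mul_le_mul_of_nonneg_left (add_le_add ?_ ?_) hK0'.le
    · exact (energy_mono (Nat.zero_le _) _ _).trans ((h1 a γ ν η w hs hd).trans
        (mul_le_mul_of_nonneg_left hd.bound hC1.le))
    · exact (nsq_le_HSq (Nat.zero_le 4) _).trans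
        (by linarith [hd.bound, HSq_nonneg 4 (w 0)])
  have hl := hs.abs_log_density_le hd ht x
  have h2 := (hs.integral_mul_sq_le ha hγ hP t).trans
    ((hs.baseDensity_antitone ha hγ hν hP ht).trans hF0)
  have h3 : (∫ x in (0:ℝ)..1, η t x * deriv (vol η t) x ^ 2)
      ≤ 4 / ν ^ 2 * (K0 * (C1 * A + A)) := by
    rw [div_mul_eq_mul_div, le_div_iff₀ (by positivity)]
    linarith
  have h5 := abs_le.1 (hl.trans (mul_le_mul_of_nonneg_left (add_le_add_left h3 1) (by norm_num)))
  exact ⟨(Real.le_log_iff_exp_le (hs.pos t x)).1 h5.1,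
    (Real.log_le_iff_le_exp (hs.pos t x)).1 h5.2⟩

/-- Decay of the basic energy. -/
lemma exists_base_lyap {a γ ν r R A : ℝ} (ha : 0 < a) (hγ : 0 < γ) (hν : 0 < ν)
    (hr : 0 < r) (hA : 0 ≤ A) :
    ∃ lo hi c C : ℝ, 0 < lo ∧ lo ≤ hi ∧ 0 < c ∧ 0 < C ∧ ∀ η w : ℝ → ℝ → ℝ,
      Sol a γ ν η w → Data r R A η w →
      (∀ t, 0 ≤ t → (∀ x, lo ≤ η t x ∧ η t x ≤ hi) ∧ Slice lo hi (w t) (vol η t)) ∧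
      ∃ L, Lyap c C 0 η w L := by
  obtain ⟨P, h, hP⟩ := exists_potential a hγ.ne'
  obtain ⟨B, hB0, hBd⟩ := exists_density_bounds (R := R) ha hγ hν hr hA
  obtain ⟨lo, hlo⟩ : ∃ lo, lo = Real.exp (-B) := ⟨_, rfl⟩
  obtain ⟨hi, hhi⟩ : ∃ hi, hi = Real.exp B := ⟨_, rfl⟩
  rw [← hlo, ← hhi] at hBd
  have hlo0 : 0 < lo := hlo ▸ Real.exp_pos _
  have hhi0 : 0 < hi := hhi ▸ Real.exp_pos _
  have hlo1 : lo ≤ 1 := hlo ▸ Real.exp_le_one_iff.2 (by linarith)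
  have hhi1 : 1 ≤ hi := hhi ▸ Real.one_le_exp hB0.le
  have hinv : lo⁻¹ = hi := by rw [hlo, hhi, Real.exp_neg, inv_inv]
  have hinv' : hi⁻¹ = lo := by rw [hlo, hhi, Real.exp_neg]
  obtain ⟨q, hq⟩ : ∃ q, q = min (lo ^ (-γ)) (hi ^ (-γ)) := ⟨_, rfl⟩
  have hq0 : 0 < q := hq ▸ lt_min (Real.rpow_pos_of_pos hlo0 _) (Real.rpow_pos_of_pos hhi0 _)
  obtain ⟨K1, hK1⟩ : ∃ K, K = 3 / 2 * hi + hi * ν ^ 2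
    + 2 * (a * γ * (lo ^ (γ - 2) + hi ^ (γ - 2))) := ⟨_, rfl⟩
  have hK1' : 0 < K1 := hK1 ▸ by positivity
  obtain ⟨c, hc⟩ : ∃ c, c = min (ν / 2) (ν * (a * γ * (lo * q))) := ⟨_, rfl⟩
  obtain ⟨C2, hC2⟩ : ∃ C, C = 2 / lo * (1 + 2 / ν ^ 2) := ⟨_, rfl⟩
  have hC2' : 0 < C2 := hC2 ▸ by positivity
  refine ⟨lo, hi, c, C2 + K1 * (1 + hi ^ 4), hlo0, hlo1.trans hhi1,
    hc ▸ lt_min (by positivity) (by positivity), by positivity, fun η w hs hd => ?_⟩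
  have hη := hBd η w hs hd
  have hsl : ∀ t, 0 ≤ t → Slice lo hi (w t) (vol η t) := fun t ht =>
    { hW := hs.hw.slice t
      hu := hs.smooth_vol.slice t
      lo_le := fun x => by
        rw [vol_eq, ← hinv']; exact inv_anti₀ (hs.pos t x) (hη t ht x).2
      le_hi := fun x => by
        rw [vol_eq, ← hinv]; exact inv_anti₀ hlo0 (hη t ht x).1
      zero := hs.exists_velocity_eq_zero hd ht }
  refine ⟨fun t ht => ⟨hη t ht, hsl t ht⟩, fun t => ∫ x in (0:ℝ)..1, baseDensity ν P η w t x,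
    ⟨fun t ht => ⟨_, hs.hasDerivAt_integral_baseDensity hP ht, ?_⟩, fun t ht => ?_, fun t ht => ?_⟩⟩
  · have hS := hsl t ht
    have hw1 := hS.hW.deriv.sq_continuous
    have hu1 := hS.hu.deriv.sq_continuous
    have hp : nsq 0 (w t) ≤ nsq 1 (w t) := l2_le_of_sq_le hS.hW.continuous (hS.sq_iter_le 0)
    have h6 : ν * nsq 1 (w t) + ν * (a * γ * (lo * q)) * l2 (deriv (vol η t))
        ≤ ∫ x in (0:ℝ)..1, ν * deriv (w t) x ^ 2
          + ν * (a * γ * (η t x * vol η t x ^ (-γ) * deriv (vol η t) x ^ 2)) := by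
      rw [nsq, Function.iterate_one, l2, l2, ← intervalIntegral.integral_const_mul,
        ← intervalIntegral.integral_const_mul, ← integral_add' (hw1.const_mul _) (hu1.const_mul _)]
      have hcr := (hS.hu.rpow (hs.vol_pos t) (-γ)).continuous
      have hcη := (hs.hη.slice t).continuous
      refine integral_le (by fun_prop) (by fun_prop) fun x => ?_
      have h7 : lo * q ≤ η t x * vol η t x ^ (-γ) :=
        mul_le_mul (hη t ht x).1 (hq ▸ min_le_rpow hlo0 (hS.lo_le x) (hS.le_hi x) _) hq0.le
          (hs.pos t x).le
      have h8 := mul_le_mul_of_nonneg_right h7 (sq_nonneg (deriv (vol η t) x))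
      have h9 := mul_le_mul_of_nonneg_left h8 (by positivity : 0 ≤ ν * (a * γ))
      linarith
    rw [diss_zero]
    have hc1 : c ≤ ν / 2 := hc ▸ min_le_left _ _
    have hc2 : c ≤ ν * (a * γ * (lo * q)) := hc ▸ min_le_right _ _
    have hn0 : 0 ≤ l2 (w t) := l2_nonneg _
    have hn1 := nsq_nonneg 1 (w t)
    have hn2 := l2_nonneg (deriv (vol η t))
    have hp' : l2 (w t) ≤ nsq 1 (w t) := hp
    have q1 := mul_le_mul_of_nonneg_right hc1 (add_nonneg hn0 hn1)
    have q2 := mul_le_mul_of_nonneg_right hc2 hn2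
    nlinarith
  · have h2 := hs.energy_zero_le ha hγ hν hP hlo0 (fun x => (hη t ht x).1)
    rw [← hC2] at h2
    have h3 : 0 ≤ ∫ x in (0:ℝ)..1, baseDensity ν P η w t x :=
      nonneg_of_mul_nonneg_right ((energy_nonneg _ _ _).trans h2) hC2'
    have h4 : 0 ≤ K1 * (1 + hi ^ 4) := by positivity
    rw [add_mul]
    exact h2.trans (le_add_of_nonneg_right (mul_nonneg h4 h3))
  · have h2 := hs.baseDensity_le ha hγ hP hlo0 hlo1 hhi1 (fun x => (hη t ht x).1)
      (fun x => (hη t ht x).2)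
    rw [← hK1] at h2
    have hS := hsl t ht
    have hm : l2 (fun x => η t x - 1) ≤ hi ^ 4 * l2 (deriv (vol η t)) := by
      obtain ⟨y, hy, hy1⟩ := hs.exists_density_eq_one hd ht
      have hη1 := (hs.hη.slice t).sub (SmoothPer.const 1)
      refine (l2_le_of_sq_le hη1.continuous (hη1.sq_le_of_zero hy (by rw [hy1, sub_self]))).trans ?_
      have e : deriv (fun x => η t x - 1) = fun x => -(η t x ^ 2 * deriv (vol η t) x) := by
        rw [deriv_sub_one]; ext x; exact hs.deriv_density t x
      rw [nsq, Function.iterate_one, e, l2_neg]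
      refine l2_mul_le (hs.hη.slice t).sq_continuous hS.hu.deriv.continuous fun x => ?_
      rw [← pow_mul]
      exact pow_le_pow_left₀ (hs.pos t x).le (hη t ht x).2 4
    refine h2.trans ?_
    have h3 : l2 (deriv (vol η t)) ≤ energy 0 (w t) (vol η t) := by
      rw [energy_zero]; linarith [l2_nonneg (w t)]
    have h4 := energy_nonneg 0 (w t) (vol η t)
    have h5 : l2 (fun x => η t x - 1) ≤ hi ^ 4 * energy 0 (w t) (vol η t) :=
      hm.trans (mul_le_mul_of_nonneg_left h3 (by positivity))
    have h6 : 0 ≤ C2 * energy 0 (w t) (vol η t) := by positivity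
    calc _ ≤ K1 * (energy 0 (w t) (vol η t) + hi ^ 4 * energy 0 (w t) (vol η t)) :=
          mul_le_mul_of_nonneg_left (by linarith) hK1'.le
      _ ≤ _ := by linarith

/-! ### Propagation of decay to higher orders -/

lemma HSq_succ_last (k : ℕ) (f : ℝ → ℝ) : HSq (k + 1) f = HSq k f + nsq (k + 1) f := by
  rw [HSq_eq, HSq_eq, Finset.sum_range_succ]

lemma nsq_veff_le {W u : ℝ → ℝ} (hW : SmoothPer W) (hu : SmoothPer u) (ν : ℝ) (m : ℕ) :
    nsq m (veff ν W u) ≤ 2 * nsq m W + 2 * ν ^ 2 * nsq m (deriv u) := by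
  have h1 : nsq m (veff ν W u) = l2 fun x => deriv^[m] W x - ν * deriv^[m] (deriv u) x := by
    rw [nsq, show veff ν W u = fun x => W x - ν * deriv u x from rfl, iter_sub hW (hu.deriv.const_mul ν), iter_const_mul hu.deriv]
  rw [h1]
  refine (l2_sub_le (hW.iter m).continuous ((hu.deriv.iter m).continuous.const_mul ν)).trans ?_
  rw [l2_const_mul]
  simp only [nsq]
  linarith

lemma nsq_deriv_le {W u : ℝ → ℝ} (hW : SmoothPer W) (hu : SmoothPer u) {ν : ℝ} (hν : 0 < ν)
    (m : ℕ) : nsq m (deriv u) ≤ 2 / ν ^ 2 * (nsq m W + nsq m (veff ν W u)) := by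
  have hv := hW.veff hu ν
  have h1 : ν ^ 2 * nsq m (deriv u) = l2 fun x => deriv^[m] W x - deriv^[m] (veff ν W u) x := by
    rw [nsq, ← l2_const_mul]
    congr 1
    ext x
    rw [show veff ν W u = fun x => W x - ν * deriv u x from rfl, iter_sub hW (hu.deriv.const_mul ν), iter_const_mul hu.deriv]
    ring
  rw [div_mul_eq_mul_div, le_div_iff₀ (by positivity), mul_comm, h1]
  refine (l2_sub_le (hW.iter m).continuous (hv.iter m).continuous).trans ?_
  simp only [nsq]
  linarith

/-- The functional of order `m + 1` controlling the energy of order `m + 1` modulo lower order. -/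
noncomputable def topFunctional (κ ν : ℝ) (m : ℕ) (W u : ℝ → ℝ) : ℝ :=
  κ * nsq m (veff ν W u) + nsq (m + 1) W

/-- Its time derivative. -/
noncomputable def topFunctionalDot (κ a γ ν : ℝ) (m : ℕ) (W u : ℝ → ℝ) : ℝ :=
  κ * (2 * ∫ x in (0:ℝ)..1, deriv^[m] (veff ν W u) x * deriv^[m] (dtV a γ ν W u) x)
    + 2 * ∫ x in (0:ℝ)..1, deriv^[m + 1] W x * deriv^[m + 1] (dtW a γ ν W u) x

lemma exists_topFunctional {a γ ν : ℝ} (ha : 0 < a) (hγ : 0 < γ) (hν : 0 < ν) (m : ℕ)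
    {lo hi M : ℝ} (hlo : 0 < lo) (hlohi : lo ≤ hi) (hM : 0 ≤ M) :
    ∃ κ c C K : ℝ, 0 ≤ κ ∧ 0 < c ∧ 0 < C ∧ 0 < K ∧ ∀ W u : ℝ → ℝ, Slice lo hi W u →
      HSq (m - 1) (deriv u) ≤ M →
      topFunctionalDot κ a γ ν m W u
        ≤ -c * diss (m + 1) W u + C * (diss m W u * (1 + energy (m + 1) W u)) ∧
      energy (m + 1) W u ≤ K * (energy m W u + topFunctional κ ν m W u) ∧
      topFunctional κ ν m W u ≤ K * energy (m + 1) W u := by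
  obtain ⟨Cw, hCw, hw⟩ := exists_velocity_energy_le a γ hν m (hi := hi) hlo hM
  rcases Nat.eq_zero_or_pos m with rfl | hm
  · refine ⟨0, ν * lo, 2 * Cw + ν * lo, 1, le_rfl, by positivity, by positivity, one_pos,
      fun W u hS hb => ⟨?_, ?_, ?_⟩⟩
    · have h1 := hw W u hS hb
      have h2 : diss (0 + 1) W u = diss 0 W u + nsq 2 W := by
        rw [diss, diss, HSq_succ_last]; simp only [zero_add, Nat.sub_self, Nat.zero_sub]; ring
      have h3 := diss_nonneg 0 W u
      have h4 := energy_nonneg (0 + 1) W u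
      have h5 : nsq 0 (deriv u) ≤ diss 0 W u :=
        (nsq_le_HSq (Nat.zero_le _) _).trans (le_add_of_nonneg_left (HSq_nonneg _ _))
      have h6 := mul_nonneg h3 h4
      rw [topFunctionalDot, zero_mul, zero_add]
      refine h1.trans ?_
      rw [h2]
      have h7 := mul_le_mul_of_nonneg_left h5 hCw.le
      have h8 := mul_nonneg hCw.le h6
      have h9 : 0 ≤ ν * lo * (diss 0 W u * energy (0 + 1) W u) := by positivity
      linarith
    · have : energy (0 + 1) W u = energy 0 W u + nsq 1 W := by
        rw [energy, energy, HSq_succ_last]; simp only [zero_add, Nat.sub_self, Nat.zero_sub]; ring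
      rw [this, topFunctional]; linarith
    · rw [topFunctional, zero_mul, zero_add, one_mul]
      exact (nsq_le_HSq le_rfl _).trans (le_add_of_nonneg_right (HSq_nonneg _ _))
  · obtain ⟨cv, Cv, hcv, hCv, hv⟩ := exists_veff_energy_le ha hγ hν hm hlo hlohi hM
    obtain ⟨m, rfl⟩ : ∃ n, m = n + 1 := ⟨m - 1, by omega⟩
    obtain ⟨d, hd, hd0⟩ : ∃ d, d = 2 / ν ^ 2 ∧ 0 < d := ⟨_, rfl, by positivity⟩
    obtain ⟨κ, hκ, hκ0⟩ : ∃ κ, κ = (Cw * d + 1) / cv ∧ 0 < κ := ⟨_, rfl, by positivity⟩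
    obtain ⟨b, hb1, hb2, hb0⟩ : ∃ b, b ≤ ν * lo ∧ b ≤ 1 ∧ 0 < b :=
      ⟨min (ν * lo) 1, min_le_left _ _, min_le_right _ _, lt_min (by positivity) one_pos⟩
    refine ⟨κ, b / (1 + d), κ * Cv + Cw * d + Cw + b,
      (1 + d) * (1 + 1 / κ) + (2 * κ + 2 * ν ^ 2 * κ + 1),
      hκ0.le, by positivity, by positivity, by positivity, fun W u hS hb => ?_⟩
    have hW := hS.hW
    have hu := hS.hu
    have n1 := nsq_nonneg (m + 1) (veff ν W u)
    have n2 := nsq_nonneg (m + 2) W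
    have n3 := nsq_nonneg (m + 1) (deriv u)
    have n4 := nsq_nonneg (m + 1) W
    have n5 := nsq_nonneg (m + 3) W
    have n6 := nsq_deriv_le hW hu hν (m + 1)
    rw [← hd] at n6
    have eE : energy (m + 1 + 1) W u
        = energy (m + 1) W u + nsq (m + 2) W + nsq (m + 1) (deriv u) := by
      rw [energy, energy, HSq_succ_last]
      simp only [Nat.add_sub_cancel]
      rw [HSq_succ_last m (deriv u)]
      ring
    have eD : diss (m + 1 + 1) W u
        = diss (m + 1) W u + nsq (m + 3) W + nsq (m + 1) (deriv u) := by
      rw [diss, diss, HSq_succ_last]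
      simp only [Nat.add_sub_cancel]
      rw [HSq_succ_last m (deriv u)]
      ring
    have nE := energy_nonneg (m + 1) W u
    have nD := diss_nonneg (m + 1) W u
    have hE1 : nsq (m + 1) W ≤ energy (m + 1) W u :=
      (nsq_le_HSq le_rfl _).trans (le_add_of_nonneg_right (HSq_nonneg _ _))
    have hD1 := hE1.trans (energy_le_diss (m + 1) W u)
    refine ⟨?_, ?_, ?_⟩
    · have h1 := hw W u hS hb
      have h2 := mul_le_mul_of_nonneg_left (hv W u hS hb) hκ0.le
      have nE2 := energy_nonneg (m + 1 + 1) W u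
      have h3 : κ * cv = Cw * d + 1 := by rw [hκ]; field_simp
      have h4 := mul_le_mul_of_nonneg_left n6 hCw.le
      obtain ⟨Z, hZ⟩ : ∃ Z, Z = diss (m + 1) W u * (1 + energy (m + 1 + 1) W u) := ⟨_, rfl⟩
      have hDZ : diss (m + 1) W u ≤ Z := by
        rw [hZ]; exact le_mul_of_one_le_right nD (by linarith)
      rw [← hZ] at h1 h2 ⊢
      have h5 : topFunctionalDot κ a γ ν (m + 1) W u
          ≤ -b * (nsq (m + 3) W + nsq (m + 1) (veff ν W u))
            + (κ * Cv + Cw * d + Cw) * Z := by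
        have q1 := mul_le_mul_of_nonneg_right hb1 n5
        have q2 := mul_le_mul_of_nonneg_right hb2 n1
        have q3 : κ * (-cv * nsq (m + 1) (veff ν W u))
            = -(Cw * d + 1) * nsq (m + 1) (veff ν W u) := by rw [← h3]; ring
        have q4 := mul_le_mul_of_nonneg_left (hD1.trans hDZ) (mul_nonneg hCw.le hd0.le)
        rw [topFunctionalDot]
        rw [mul_add] at h2
        linarith
      have h6 : b / (1 + d) * diss (m + 1 + 1) W u
          ≤ b * (nsq (m + 3) W + nsq (m + 1) (veff ν W u)) + b * Z := by
        rw [div_mul_eq_mul_div, div_le_iff₀ (by positivity), ← mul_add, mul_assoc]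
        refine mul_le_mul_of_nonneg_left ?_ hb0.le
        rw [eD]
        nlinarith [mul_nonneg hd0.le n5, mul_le_mul_of_nonneg_left (hD1.trans hDZ) hd0.le]
      linarith
    · rw [eE, topFunctional]
      obtain ⟨k, hk, hk0⟩ : ∃ k, k = 1 / κ ∧ 0 < k := ⟨_, rfl, by positivity⟩
      have hkκ : k * κ = 1 := by rw [hk]; field_simp
      obtain ⟨Y, hY⟩ : ∃ Y, Y = κ * nsq (m + 1) (veff ν W u) + nsq (m + 1 + 1) W := ⟨_, rfl⟩
      have hY0 : 0 ≤ Y := by rw [hY]; positivity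
      have hY1 : nsq (m + 2) W ≤ Y := by
        rw [hY]; exact le_add_of_nonneg_left (by positivity)
      have hY2 : nsq (m + 1) (veff ν W u) ≤ k * Y := by
        rw [hY, mul_add, ← mul_assoc, hkκ, one_mul]
        exact le_add_of_nonneg_right (by positivity)
      rw [← hY, ← hk]
      have q1 := mul_le_mul_of_nonneg_left (add_le_add hE1 hY2) hd0.le
      have q2 : 0 ≤ (2 * κ + 2 * ν ^ 2 * κ + 1) * (energy (m + 1) W u + Y) := by positivity
      have q3 : 0 ≤ d * Y + k * energy (m + 1) W u + k * Y + d * k * energy (m + 1) W u := by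
        positivity
      linarith
    · rw [topFunctional]
      have h1 := mul_le_mul_of_nonneg_left (nsq_veff_le hW hu ν (m + 1)) hκ0.le
      have q1 : nsq (m + 1) W ≤ energy (m + 1 + 1) W u := by rw [eE]; linarith
      have q2 : nsq (m + 1) (deriv u) ≤ energy (m + 1 + 1) W u := by rw [eE]; linarith
      have q3 : nsq (m + 1 + 1) W ≤ energy (m + 1 + 1) W u := by
        rw [eE]; linarith [show nsq (m + 1 + 1) W = nsq (m + 2) W from rfl]
      have q4 := mul_le_mul_of_nonneg_left q1 hκ0.le
      have q5 := mul_le_mul_of_nonneg_left q2 (by positivity : 0 ≤ ν ^ 2 * κ)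
      have q6 : 0 ≤ (1 + d) * (1 + 1 / κ) * energy (m + 1 + 1) W u :=
        mul_nonneg (by positivity) (energy_nonneg _ _ _)
      linarith

lemma exists_lyap_succ {a γ ν : ℝ} (ha : 0 < a) (hγ : 0 < γ) (hν : 0 < ν) (m : ℕ)
    {lo hi M c C : ℝ} (hlo : 0 < lo) (hlohi : lo ≤ hi) (hM : 0 ≤ M) (hc : 0 < c) (hC : 0 < C) :
    ∃ c' C' : ℝ, 0 < c' ∧ 0 < C' ∧ ∀ η w L, Sol a γ ν η w →
      (∀ t, 0 ≤ t → Slice lo hi (w t) (vol η t)) →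
      (∀ t, 0 ≤ t → energy m (w t) (vol η t) ≤ M) → Lyap c C m η w L →
      ∃ L', Lyap c' C' (m + 1) η w L' := by
  obtain ⟨κ, c1, C1, K, hκ, hc1, hC1, hK, hY⟩ := exists_topFunctional ha hγ hν m hlo hlohi hM
  obtain ⟨l, hl, hl0⟩ : ∃ l, l = C1 * K / c ∧ 0 < l := ⟨_, rfl, by positivity⟩
  have hlc : l * c = C1 * K := by rw [hl]; field_simp
  obtain ⟨X, hX, hX0⟩ : ∃ X, X = Real.exp (l * (C * M)) ∧ 0 < X := ⟨_, rfl, Real.exp_pos _⟩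
  obtain ⟨B, hB, hB0⟩ : ∃ B, c * B = X * (C1 * (1 + K * M)) + c ∧ 1 ≤ B :=
    ⟨X * (C1 * (1 + K * M)) / c + 1, by field_simp, le_add_of_nonneg_left (by positivity)⟩
  refine ⟨c1, K * (C + 1) + (X * K + B * C), hc1, by positivity, fun η w L hs hS hE hL => ?_⟩
  refine ⟨fun t => Real.exp (l * L t) * topFunctional κ ν m (w t) (vol η t) + B * L t, ?_⟩
  have hYt := fun t (ht : 0 ≤ t) => hY (w t) (vol η t) (hS t ht)
    ((le_add_of_nonneg_left (HSq_nonneg m (w t))).trans (hE t ht))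
  have hL0 : ∀ t, 0 ≤ t → 0 ≤ L t := fun t ht =>
    nonneg_of_mul_nonneg_right ((energy_nonneg _ _ _).trans (hL.lower t ht)) hC
  have hY0 : ∀ t, 0 ≤ topFunctional κ ν m (w t) (vol η t) := fun t =>
    add_nonneg (mul_nonneg hκ (nsq_nonneg _ _)) (nsq_nonneg _ _)
  have he1 : ∀ t, 0 ≤ t → 1 ≤ Real.exp (l * L t) := fun t ht =>
    Real.one_le_exp (mul_nonneg hl0.le (hL0 t ht))
  have heX : ∀ t, 0 ≤ t → Real.exp (l * L t) ≤ X := fun t ht => by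
    rw [hX]
    exact Real.exp_le_exp.2 (mul_le_mul_of_nonneg_left
      ((hL.upper t ht).trans (mul_le_mul_of_nonneg_left (hE t ht) hC.le)) hl0.le)
  refine ⟨fun t ht => ?_, fun t ht => ?_, fun t ht => ?_⟩
  · obtain ⟨d, hd, hd1⟩ := hL.deriv t ht
    have hYd : HasDerivAt (fun t => topFunctional κ ν m (w t) (vol η t))
        (topFunctionalDot κ a γ ν m (w t) (vol η t)) t :=
      ((hs.hasDerivAt_nsq_effv m ht).const_mul κ).add (hs.hasDerivAt_nsq_velocity (m + 1) ht)
    refine ⟨_, ((hd.const_mul l).exp.fun_mul hYd).fun_add (hd.const_mul B), ?_⟩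
    obtain ⟨h1, h2, -⟩ := hYt t ht
    have h0 := hL0 t ht
    have hY0 := hY0 t
    have he1 := he1 t ht
    have heX := heX t ht
    have hE := hE t ht
    have nD := diss_nonneg m (w t) (vol η t)
    have nD' := diss_nonneg (m + 1) (w t) (vol η t)
    generalize topFunctionalDot κ a γ ν m (w t) (vol η t) = Yd at *
    generalize topFunctional κ ν m (w t) (vol η t) = Y at *
    generalize energy (m + 1) (w t) (vol η t) = E' at *
    generalize energy m (w t) (vol η t) = E at *
    generalize diss (m + 1) (w t) (vol η t) = D' at *
    generalize diss m (w t) (vol η t) = D at *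
    generalize Real.exp (l * L t) = e at *
    have a1 : Yd ≤ -c1 * D' + C1 * (1 + K * M) * D + C1 * K * D * Y := by
      have := mul_le_mul_of_nonneg_left h2 (by positivity : 0 ≤ C1 * D)
      have := mul_le_mul_of_nonneg_left hE (by positivity : 0 ≤ C1 * D * K)
      linarith
    have a2 := mul_le_mul_of_nonneg_left a1 (by linarith : 0 ≤ e)
    have a3 : e * (l * d) * Y ≤ e * (-(C1 * K * D)) * Y := by
      rw [← hlc]
      refine mul_le_mul_of_nonneg_right (mul_le_mul_of_nonneg_left ?_ (by linarith)) hY0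
      have := mul_le_mul_of_nonneg_left hd1 hl0.le
      linarith
    have a4 : B * d ≤ -(X * (C1 * (1 + K * M)) + c) * D := by
      rw [← hB]
      have := mul_le_mul_of_nonneg_left hd1 (by linarith : 0 ≤ B)
      linarith
    have a5 := mul_le_mul_of_nonneg_right heX (by positivity : 0 ≤ C1 * (1 + K * M) * D)
    have a6 := mul_le_mul_of_nonneg_right he1 (by positivity : 0 ≤ c1 * D')
    have a7 := mul_nonneg hc.le nD
    linarith
  · obtain ⟨-, h2, -⟩ := hYt t ht
    have h3 := hL.lower t ht
    have a1 := le_mul_of_one_le_left (hY0 t) (he1 t ht)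
    have a2 := le_mul_of_one_le_left (hL0 t ht) hB0
    have hY0 := hY0 t
    have hL0 := hL0 t ht
    generalize Real.exp (l * L t) * topFunctional κ ν m (w t) (vol η t) = Z at *
    have a3 : energy m (w t) (vol η t) + topFunctional κ ν m (w t) (vol η t)
        ≤ (C + 1) * (Z + B * L t) := by
      have := mul_le_mul_of_nonneg_left a2 hC.le
      have := mul_nonneg hC.le (hY0.trans a1)
      linarith
    refine (h2.trans (mul_le_mul_of_nonneg_left a3 hK.le)).trans ?_
    rw [← mul_assoc]
    exact mul_le_mul_of_nonneg_right (le_add_of_nonneg_right (by positivity)) (by linarith)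
  · obtain ⟨-, -, h3⟩ := hYt t ht
    have a1 := mul_le_mul (heX t ht) h3 (hY0 t) hX0.le
    have a2 := mul_le_mul_of_nonneg_left ((hL.upper t ht).trans (mul_le_mul_of_nonneg_left
      (energy_mono (Nat.le_succ m) _ _) hC.le)) (by linarith : 0 ≤ B)
    have a3 : 0 ≤ K * (C + 1) * energy (m + 1) (w t) (vol η t) :=
      mul_nonneg (by positivity) (energy_nonneg _ _ _)
    linarith

lemma Lyap.antitone {c C : ℝ} {k : ℕ} {η w : ℝ → ℝ → ℝ} {L : ℝ → ℝ} (hc : 0 < c)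
    (hL : Lyap c C k η w L) {t : ℝ} (ht : 0 ≤ t) : L t ≤ L 0 := by
  refine le_of_deriv_nonpos (fun t ht => ?_) ht
  obtain ⟨d, h1, h2⟩ := hL.deriv t ht
  exact ⟨d, h1, h2.trans (by have := mul_nonneg hc.le (diss_nonneg k (w t) (vol η t)); linarith)⟩

lemma Lyap.energy_le {c C : ℝ} {k : ℕ} {η w : ℝ → ℝ → ℝ} {L : ℝ → ℝ} (hc : 0 < c) (hC : 0 < C)
    (hL : Lyap c C k η w L) {t : ℝ} (ht : 0 ≤ t) :
    energy k (w t) (vol η t) ≤ C ^ 2 * energy k (w 0) (vol η 0) := by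
  refine (hL.lower t ht).trans ?_
  rw [sq, mul_assoc]
  exact mul_le_mul_of_nonneg_left ((hL.antitone hc ht).trans (hL.upper 0 le_rfl)) hC.le

lemma Lyap.decay {c C : ℝ} {k : ℕ} {η w : ℝ → ℝ → ℝ} {L : ℝ → ℝ} (hc : 0 < c) (hC : 0 < C)
    (hL : Lyap c C k η w L) {t : ℝ} (ht : 0 ≤ t) :
    energy k (w t) (vol η t)
      ≤ C ^ 2 * energy k (w 0) (vol η 0) * Real.exp (-(c / C) * t) := by
  have h1 : L t * Real.exp (c / C * t) ≤ L 0 * Real.exp (c / C * 0) := by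
    refine le_of_deriv_nonpos (L := fun t => L t * Real.exp (c / C * t)) (fun t ht => ?_) ht
    obtain ⟨d, h1, h2⟩ := hL.deriv t ht
    refine ⟨_, h1.fun_mul ((hasDerivAt_id t).const_mul (c / C)).exp, ?_⟩
    have h3 : c / C * L t ≤ c * diss k (w t) (vol η t) := by
      rw [div_mul_eq_mul_div, div_le_iff₀ hC, mul_assoc]
      refine mul_le_mul_of_nonneg_left ((hL.upper t ht).trans ?_) hc.le
      rw [mul_comm]
      exact mul_le_mul_of_nonneg_right (energy_le_diss _ _ _) hC.le
    have h4 := Real.exp_pos (c / C * t)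
    have h5 : d + c / C * L t ≤ 0 := by linarith
    simp only [id]
    have h6 := mul_nonpos_of_nonpos_of_nonneg h5 h4.le
    linarith
  rw [mul_zero, Real.exp_zero, mul_one] at h1
  have h2 : L t ≤ L 0 * Real.exp (-(c / C) * t) := by
    rw [neg_mul, Real.exp_neg, ← div_eq_mul_inv, le_div_iff₀ (Real.exp_pos _)]
    exact h1
  refine (hL.lower t ht).trans ((mul_le_mul_of_nonneg_left (h2.trans
    (mul_le_mul_of_nonneg_right (hL.upper 0 le_rfl) (Real.exp_pos _).le)) hC.le).trans_eq ?_)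
  ring

/-- Exponential decay of the energy of order five. -/
lemma exists_energy_decay {a γ ν r R A : ℝ} (ha : 0 < a) (hγ : 0 < γ) (hν : 0 < ν)
    (hr : 0 < r) (hA : 0 ≤ A) :
    ∃ lo hi M β C : ℝ, 0 < lo ∧ lo ≤ hi ∧ 0 ≤ M ∧ 0 < β ∧ 0 < C ∧ ∀ η w : ℝ → ℝ → ℝ,
      Sol a γ ν η w → Data r R A η w → ∀ t, 0 ≤ t →
        (∀ x, lo ≤ η t x ∧ η t x ≤ hi) ∧ Slice lo hi (w t) (vol η t) ∧
        energy 4 (w t) (vol η t) ≤ M ∧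
        energy 5 (w t) (vol η t)
          ≤ C * (HSq 5 (fun x => η 0 x - 1) + HSq 5 (w 0)) * Real.exp (-β * t) := by
  obtain ⟨lo, hi, c0, C0, hlo, hlohi, hc0, hC0, hbase⟩ := exists_base_lyap (R := R) ha hγ hν hr hA
  obtain ⟨C1, hC1, h1⟩ := exists_initial_energy_le (R := R) hr hA (m := 3) (by norm_num)
  obtain ⟨C2, hC2, h2⟩ := exists_initial_energy_le (R := R) hr hA (m := 4) (by norm_num)
  have hbd : ∀ k ≤ 4, ∀ η w, Sol a γ ν η w → Data r R A η w →
      energy k (w 0) (vol η 0) ≤ C1 * A := fun k hk η w hs hd =>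
    (energy_mono hk _ _).trans ((h1 a γ ν η w hs hd).trans
      (mul_le_mul_of_nonneg_left hd.bound hC1.le))
  have hall : ∀ k ≤ 5, ∃ c C : ℝ, 0 < c ∧ 0 < C ∧ ∀ η w : ℝ → ℝ → ℝ,
      Sol a γ ν η w → Data r R A η w → ∃ L, Lyap c C k η w L := by
    intro k
    induction k with
    | zero => exact fun _ => ⟨c0, C0, hc0, hC0, fun η w hs hd => (hbase η w hs hd).2⟩
    | succ k ih =>
      intro hk
      obtain ⟨c, C, hc, hC, hL⟩ := ih (by omega)
      obtain ⟨c', C', hc', hC', hstep⟩ := exists_lyap_succ ha hγ hν k hlo hlohi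
        (by positivity : 0 ≤ C ^ 2 * (C1 * A)) hc hC
      refine ⟨c', C', hc', hC', fun η w hs hd => ?_⟩
      obtain ⟨L, hL⟩ := hL η w hs hd
      exact hstep η w L hs (fun t ht => ((hbase η w hs hd).1 t ht).2)
        (fun t ht => (hL.energy_le hc hC ht).trans
          (mul_le_mul_of_nonneg_left (hbd k (by omega) η w hs hd) (by positivity))) hL
  obtain ⟨c4, C4, hc4, hC4, hL4⟩ := hall 4 (by norm_num)
  obtain ⟨c5, C5, hc5, hC5, hL5⟩ := hall 5 le_rfl
  refine ⟨lo, hi, C4 ^ 2 * (C1 * A), c5 / C5, C5 ^ 2 * C2, hlo, hlohi, by positivity,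
    by positivity, by positivity, fun η w hs hd t ht => ?_⟩
  obtain ⟨hb, hS⟩ := (hbase η w hs hd).1 t ht
  obtain ⟨L4, hL4⟩ := hL4 η w hs hd
  obtain ⟨L5, hL5⟩ := hL5 η w hs hd
  refine ⟨hb, hS, (hL4.energy_le hc4 hC4 ht).trans
    (mul_le_mul_of_nonneg_left (hbd 4 le_rfl η w hs hd) (by positivity)), ?_⟩
  refine (hL5.decay hc5 hC5 ht).trans (mul_le_mul_of_nonneg_right ?_ (Real.exp_pos _).le)
  rw [mul_assoc]
  exact mul_le_mul_of_nonneg_left (h2 a γ ν η w hs hd) (by positivity)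

/-! ### Families of functions with uniformly controlled Sobolev norms -/

/-- A family of smooth periodic functions whose squared `H^k` norms are bounded by a constant
multiple of `e`. -/
def Dominated {ι : Type*} (k : ℕ) (e : ι → ℝ) (F : ι → ℝ → ℝ) : Prop :=
  ∃ C : ℝ, 0 < C ∧ ∀ i, SmoothPer (F i) ∧ HSq k (F i) ≤ C * e i

/-- A family of smooth periodic functions with bounded `H^k` norms. -/
abbrev Bounded {ι : Type*} (k : ℕ) (F : ι → ℝ → ℝ) : Prop := Dominated k (fun _ => 1) F

namespace Dominated

variable {ι : Type*} {j k : ℕ} {e : ι → ℝ} {F G : ι → ℝ → ℝ}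

lemma mono (hF : Dominated k e F) (h : j ≤ k) : Dominated j e F :=
  let ⟨C, hC, hb⟩ := hF
  ⟨C, hC, fun i => ⟨(hb i).1, (HSq_mono h _).trans (hb i).2⟩⟩

lemma add (hF : Dominated k e F) (hG : Dominated k e G) :
    Dominated k e fun i x => F i x + G i x := by
  obtain ⟨C, hC, hF⟩ := hF
  obtain ⟨D, hD, hG⟩ := hG
  refine ⟨2 * C + 2 * D, by positivity, fun i => ⟨(hF i).1.add (hG i).1, ?_⟩⟩
  linarith [HSq_add_le (hF i).1 (hG i).1 k, (hF i).2, (hG i).2]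

lemma const_mul (hF : Dominated k e F) (c : ℝ) : Dominated k e fun i x => c * F i x := by
  obtain ⟨C, hC, hF⟩ := hF
  refine ⟨(c ^ 2 + 1) * C, by positivity, fun i => ⟨(hF i).1.const_mul c, ?_⟩⟩
  rw [HSq_const_mul (hF i).1]
  nlinarith [mul_le_mul_of_nonneg_left (hF i).2 (sq_nonneg c), HSq_nonneg k (F i), (hF i).2]

lemma neg (hF : Dominated k e F) : Dominated k e fun i x => -F i x := by
  simpa using hF.const_mul (-1)

lemma deriv (hF : Dominated (k + 1) e F) : Dominated k e fun i => deriv (F i) :=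
  let ⟨C, hC, hb⟩ := hF
  ⟨C, hC, fun i => ⟨(hb i).1.deriv, (HSq_deriv_le k _).trans (hb i).2⟩⟩

lemma mul (hF : Bounded k F) (hG : Dominated k e G) (hk : 1 ≤ k) :
    Dominated k e fun i x => F i x * G i x := by
  obtain ⟨C, hC, hF⟩ := hF
  obtain ⟨D, hD, hG⟩ := hG
  obtain ⟨K, hK, hmul⟩ := exists_HSq_mul_le hk
  refine ⟨K * (C * D), by positivity, fun i => ⟨(hF i).1.mul (hG i).1, ?_⟩⟩
  calc _ ≤ K * (HSq k (F i) * HSq k (G i)) := hmul _ _ (hF i).1 (hG i).1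
    _ ≤ K * (C * 1 * (D * e i)) := mul_le_mul_of_nonneg_left
        (mul_le_mul (hF i).2 (hG i).2 (HSq_nonneg _ _) (by positivity)) hK.le
    _ = _ := by ring

lemma mul' (hF : Dominated k e F) (hG : Bounded k G) (hk : 1 ≤ k) :
    Dominated k e fun i x => F i x * G i x := by
  simpa only [mul_comm] using hG.mul hF hk

end Dominated

/-! ### Control of time derivatives by the energy -/

/-- A solution at a fixed nonnegative time, with the uniform bounds available there. -/
structure Snapshot (a γ ν lo hi M : ℝ) where
  η : ℝ → ℝ → ℝ
  w : ℝ → ℝ → ℝ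
  t : ℝ
  sol : Sol a γ ν η w
  nonneg : 0 ≤ t
  slice : Slice lo hi (w t) (vol η t)
  energy_le : energy 4 (w t) (vol η t) ≤ M
  eq_one : ∃ y ∈ Set.Icc (0:ℝ) 1, η t y = 1

namespace Snapshot

variable {a γ ν lo hi M : ℝ}

/-- The energy of order five of a snapshot. -/
noncomputable def E (p : Snapshot a γ ν lo hi M) : ℝ := energy 5 (p.w p.t) (vol p.η p.t)

lemma dominated_velocity : Dominated 5 E fun p : Snapshot a γ ν lo hi M => p.w p.t :=
  ⟨1, one_pos, fun p => ⟨p.slice.hW, by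
    rw [one_mul]; exact le_add_of_nonneg_right (HSq_nonneg _ _)⟩⟩

lemma dominated_deriv_vol :
    Dominated 4 E fun p : Snapshot a γ ν lo hi M => deriv (vol p.η p.t) :=
  ⟨1, one_pos, fun p => ⟨p.slice.hu.deriv, by
    rw [one_mul]; exact le_add_of_nonneg_left (HSq_nonneg _ _)⟩⟩

lemma bounded_velocity (hM : 0 ≤ M) : Bounded 4 fun p : Snapshot a γ ν lo hi M => p.w p.t :=
  ⟨M + 1, by positivity, fun p => ⟨p.slice.hW, by
    linarith [p.energy_le, le_add_of_nonneg_right (a := HSq 4 (p.w p.t))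
      (HSq_nonneg 3 (deriv (vol p.η p.t))), show energy 4 (p.w p.t) (vol p.η p.t)
      = HSq 4 (p.w p.t) + HSq 3 (deriv (vol p.η p.t)) from rfl]⟩⟩

lemma HSq_deriv_vol_le (p : Snapshot a γ ν lo hi M) : HSq 3 (deriv (vol p.η p.t)) ≤ M :=
  (le_add_of_nonneg_left (HSq_nonneg _ _)).trans p.energy_le

lemma bounded_vol_rpow (hlo : 0 < lo) (hM : 0 ≤ M) (s : ℝ) :
    Bounded 4 fun (p : Snapshot a γ ν lo hi M) x => vol p.η p.t x ^ s := by
  obtain ⟨C, hC, h⟩ := exists_HSq_deriv_rpow_le 3 (lo := lo) (hi := hi) (M := hi ^ 2 + M) hlo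
    (by positivity) s
  refine ⟨(lo ^ s + hi ^ s) ^ 2 + C * M + 1, by positivity, fun p => ?_⟩
  have hS := p.slice
  have hpos : ∀ x, 0 < vol p.η p.t x := fun x => hlo.trans_le (hS.lo_le x)
  have hr := hS.hu.rpow hpos s
  refine ⟨hr, ?_⟩
  have h1 := h _ hS.hu hS.lo_le hS.le_hi ((HSq_le_of_deriv hS.hu (fun x => (hpos x).le)
    hS.le_hi 3).trans (add_le_add le_rfl p.HSq_deriv_vol_le))
  have h2 : nsq 0 (fun x => vol p.η p.t x ^ s) ≤ (lo ^ s + hi ^ s) ^ 2 :=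
    l2_le_of_sq_le hr.continuous fun x => rpow_sq_le hlo (hS.lo_le x) (hS.le_hi x) s
  rw [HSq_succ]
  linarith [mul_le_mul_of_nonneg_left p.HSq_deriv_vol_le hC.le]

lemma bounded_density (hlo : 0 < lo) (hM : 0 ≤ M) :
    Bounded 4 fun p : Snapshot a γ ν lo hi M => p.η p.t := by
  have h : (fun p : Snapshot a γ ν lo hi M => p.η p.t) = fun p x => vol p.η p.t x ^ (-1 : ℝ) :=
    funext fun p => eq_vol_rpow p.η p.t
  rw [h]
  exact bounded_vol_rpow hlo hM (-1)

lemma bounded_vol (hlo : 0 < lo) (hM : 0 ≤ M) :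
    Bounded 4 fun p : Snapshot a γ ν lo hi M => vol p.η p.t := by
  simpa only [Real.rpow_one] using
    bounded_vol_rpow (a := a) (γ := γ) (ν := ν) (hi := hi) hlo hM 1

lemma bounded_deriv_vol (hM : 0 ≤ M) :
    Bounded 3 fun p : Snapshot a γ ν lo hi M => deriv (vol p.η p.t) :=
  ⟨M + 1, by positivity, fun p => ⟨p.slice.hu.deriv, by linarith [p.HSq_deriv_vol_le]⟩⟩

lemma dominated_density_sub_one (hlo : 0 < lo) (hM : 0 ≤ M) :
    Dominated 4 E fun (p : Snapshot a γ ν lo hi M) x => p.η p.t x - 1 := by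
  obtain ⟨C, hC, h⟩ := exists_HSq_deriv_rpow_le 3 (lo := lo) (hi := hi) (M := hi ^ 2 + M) hlo
    (by positivity) (-1)
  refine ⟨2 * C, by positivity, fun p => ?_⟩
  have hS := p.slice
  have hη := p.sol.hη.slice p.t
  have hη1 : SmoothPer fun x => p.η p.t x - 1 := hη.sub (SmoothPer.const 1)
  refine ⟨hη1, ?_⟩
  have h1 := h _ hS.hu hS.lo_le hS.le_hi ((HSq_le_of_deriv hS.hu
    (fun x => (p.sol.vol_pos p.t x).le) hS.le_hi 3).trans (add_le_add le_rfl p.HSq_deriv_vol_le))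
  rw [← eq_vol_rpow] at h1
  obtain ⟨y, hy, hy1⟩ := p.eq_one
  have h2 : nsq 0 (fun x => p.η p.t x - 1) ≤ nsq 1 fun x => p.η p.t x - 1 :=
    l2_le_of_sq_le hη1.continuous fun x => hη1.sq_le_of_zero hy (by rw [hy1, sub_self]) x
  have h3 : nsq 1 (fun x => p.η p.t x - 1) = nsq 0 (deriv (p.η p.t)) := by
    rw [nsq_succ, deriv_sub_one]
  have h4 := nsq_le_HSq (j := 0) (k := 3) (by norm_num) (deriv (p.η p.t))
  have h5 : HSq 3 (deriv (vol p.η p.t)) ≤ E p :=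
    (HSq_mono (by norm_num : 3 ≤ 4) _).trans (le_add_of_nonneg_left (HSq_nonneg _ _))
  rw [HSq_succ, deriv_sub_one]
  linarith [mul_le_mul_of_nonneg_left h5 hC.le]

lemma Dt_density_eq (p : Snapshot a γ ν lo hi M) :
    Dt p.η p.t = fun x => -deriv (fun y => p.η p.t y * p.w p.t y) x := by
  ext x
  linarith [p.sol.mass p.t x p.nonneg]

lemma dominated_Dt_density (hlo : 0 < lo) (hM : 0 ≤ M) :
    Dominated 3 E fun p : Snapshot a γ ν lo hi M => Dt p.η p.t := by
  simp only [Dt_density_eq]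
  exact ((bounded_density hlo hM).mul (dominated_velocity.mono (by norm_num))
    (by norm_num)).deriv.neg

lemma dominated_Dt_velocity (hlo : 0 < lo) (hM : 0 ≤ M) :
    Dominated 3 E fun p : Snapshot a γ ν lo hi M => Dt p.w p.t := by
  have h : ∀ p : Snapshot a γ ν lo hi M, Dt p.w p.t = dtW a γ ν (p.w p.t) (vol p.η p.t) :=
    fun p => p.sol.Dt_velocity p.nonneg
  simp only [h]
  have hw : Dominated 5 E fun p : Snapshot a γ ν lo hi M => p.w p.t := dominated_velocity
  refine (Dominated.neg ?_).add ((Dominated.const_mul ?_ ν).add (Dominated.const_mul ?_ (a * γ)))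
  · exact ((bounded_velocity hM).mono (by norm_num)).mul (hw.deriv.mono (by norm_num))
      (by norm_num)
  · exact ((bounded_vol hlo hM).mono (by norm_num)).mul hw.deriv.deriv (by norm_num)
  · exact ((bounded_vol_rpow hlo hM _).mono (by norm_num)).mul
      (dominated_deriv_vol.mono (by norm_num)) (by norm_num)

lemma Dt_vol_eq (p : Snapshot a γ ν lo hi M) :
    Dt (vol p.η) p.t = fun x => vol p.η p.t x * deriv (p.w p.t) x
      + -(p.w p.t x * deriv (vol p.η p.t) x) := by
  simp only [p.sol.Dt_vol p.nonneg, sub_eq_add_neg]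

lemma dominated_Dt_vol (hlo : 0 < lo) (hM : 0 ≤ M) :
    Dominated 3 E fun p : Snapshot a γ ν lo hi M => Dt (vol p.η) p.t := by
  simp only [Dt_vol_eq]
  refine (((bounded_vol hlo hM).mono (by norm_num)).mul
    (dominated_velocity.deriv.mono (by norm_num)) (by norm_num)).add (Dominated.neg ?_)
  exact ((bounded_velocity hM).mono (by norm_num)).mul (dominated_deriv_vol.mono (by norm_num))
    (by norm_num)

lemma bounded_Dt_vol (hlo : 0 < lo) (hM : 0 ≤ M) :
    Bounded 3 fun p : Snapshot a γ ν lo hi M => Dt (vol p.η) p.t := by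
  simp only [Dt_vol_eq]
  refine (((bounded_vol hlo hM).mono (by norm_num)).mul
    (bounded_velocity hM).deriv (by norm_num)).add (Dominated.neg ?_)
  exact ((bounded_velocity hM).mono (by norm_num)).mul (bounded_deriv_vol hM) (by norm_num)

lemma Dt_Dt_density_eq (p : Snapshot a γ ν lo hi M) :
    Dt (Dt p.η) p.t = fun x =>
      -deriv (fun y => Dt p.η p.t y * p.w p.t y + p.η p.t y * Dt p.w p.t y) x := by
  have hη := p.sol.hη
  have hw := p.sol.hw
  have hm := hη.mul hw
  have h1 : Dt (Dt p.η) p.t = Dt (fun t x => -Dx (fun t x => p.η t x * p.w t x) t x) p.t :=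
    hη.dt.Dt_congr hm.dx.neg (fun t ht => by
      ext x
      simp only [Dx]
      linarith [p.sol.mass t x ht]) p.nonneg
  have h2 : Dt (fun t x => p.η t x * p.w t x)
      = fun t x => Dt p.η t x * p.w t x + p.η t x * Dt p.w t x := by
    ext t x
    exact ((hη.hasDerivAt_Dt t x).fun_mul (hw.hasDerivAt_Dt t x)).deriv
  rw [h1]
  ext x
  have h3 := (hm.dx.hasDerivAt_Dt p.t x).fun_neg.deriv
  rw [hm.Dt_Dx, h2] at h3
  exact h3

lemma dominated_Dt_Dt_density (hlo : 0 < lo) (hM : 0 ≤ M) :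
    Dominated 1 E fun p : Snapshot a γ ν lo hi M => Dt (Dt p.η) p.t := by
  simp only [Dt_Dt_density_eq]
  refine (Dominated.add (k := 2) ?_ ?_).deriv.neg
  · exact ((dominated_Dt_density hlo hM).mono (by norm_num)).mul'
      ((bounded_velocity hM).mono (by norm_num)) (by norm_num)
  · exact ((bounded_density hlo hM).mono (by norm_num)).mul
      ((dominated_Dt_velocity hlo hM).mono (by norm_num)) (by norm_num)

lemma Dt_Dt_velocity_eq (p : Snapshot a γ ν lo hi M) :
    Dt (Dt p.w) p.t = fun x =>
      -(Dt p.w p.t x * deriv (p.w p.t) x + p.w p.t x * deriv (Dt p.w p.t) x)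
      + (ν * (Dt (vol p.η) p.t x * deriv (deriv (p.w p.t)) x
          + vol p.η p.t x * deriv (deriv (Dt p.w p.t)) x)
        + a * γ * (-γ * (vol p.η p.t x ^ (-γ - 1) * Dt (vol p.η) p.t x) * deriv (vol p.η p.t) x
          + vol p.η p.t x ^ (-γ) * deriv (Dt (vol p.η) p.t) x)) := by
  have hw := p.sol.hw
  have hu := p.sol.smooth_vol
  have hpos := p.sol.vol_pos
  have h1 : Dt (Dt p.w) p.t = Dt (fun t => dtW a γ ν (p.w t) (vol p.η t)) p.t :=
    hw.dt.Dt_congr (((hw.mul hw.dx).neg).add (((hu.mul hw.dx.dx).const_mul ν).add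
      (((hu.rpow hpos (-γ)).mul hu.dx).const_mul (a * γ))))
      (fun t ht => p.sol.Dt_velocity ht) p.nonneg
  rw [h1]
  ext x
  have hQ := (hu.hasDerivAt_Dt p.t x).rpow_const (p := -γ) (Or.inl (hpos p.t x).ne')
  have h2 := ((hw.hasDerivAt_Dt p.t x).fun_mul (hw.dx.hasDerivAt_Dt p.t x)).fun_neg.fun_add
    ((((hu.hasDerivAt_Dt p.t x).fun_mul (hw.dx.dx.hasDerivAt_Dt p.t x)).const_mul ν).fun_add
      ((hQ.fun_mul (hu.dx.hasDerivAt_Dt p.t x)).const_mul (a * γ)))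
  refine h2.deriv.trans ?_
  rw [hw.Dt_Dx, hw.dx.Dt_Dx, hw.Dt_Dx, hu.Dt_Dx]
  simp only [Dx]
  ring

lemma dominated_Dt_Dt_velocity (hlo : 0 < lo) (hM : 0 ≤ M) :
    Dominated 1 E fun p : Snapshot a γ ν lo hi M => Dt (Dt p.w) p.t := by
  simp only [Dt_Dt_velocity_eq]
  have hw : Dominated 5 E fun p : Snapshot a γ ν lo hi M => p.w p.t := dominated_velocity
  have hwt := dominated_Dt_velocity (a := a) (γ := γ) (ν := ν) (hi := hi) hlo hM
  refine (Dominated.neg (Dominated.add ?_ ?_)).add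
    ((Dominated.const_mul (Dominated.add ?_ ?_) ν).add
      (Dominated.const_mul (Dominated.add ?_ ?_) (a * γ)))
  · exact (hwt.mono (by norm_num)).mul' ((bounded_velocity hM).deriv.mono (by norm_num)) le_rfl
  · exact ((bounded_velocity hM).mono (by norm_num)).mul (hwt.deriv.mono (by norm_num)) le_rfl
  · exact ((bounded_Dt_vol hlo hM).mono (by norm_num)).mul (hw.deriv.deriv.mono (by norm_num))
      le_rfl
  · exact ((bounded_vol hlo hM).mono (by norm_num)).mul hwt.deriv.deriv le_rfl
  · exact ((((bounded_vol_rpow hlo hM _).mono (by norm_num)).mul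
      ((bounded_Dt_vol hlo hM).mono (by norm_num)) le_rfl).const_mul (-γ)).mul
      (dominated_deriv_vol.mono (by norm_num)) le_rfl
  · exact ((bounded_vol_rpow hlo hM _).mono (by norm_num)).mul
      ((dominated_Dt_vol hlo hM).deriv.mono (by norm_num)) le_rfl

end Snapshot

lemma Dominated.exists_sqrt_le {ι : Type*} {k : ℕ} {e : ι → ℝ} {F : ι → ℝ → ℝ}
    (hF : Dominated k e F) : ∃ C : ℝ, 0 < C ∧ ∀ i, √(HSq k (F i)) ≤ C * √(e i) := by
  obtain ⟨C, hC, h⟩ := hF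
  refine ⟨√C, Real.sqrt_pos.2 hC, fun i => ?_⟩
  rw [← Real.sqrt_mul hC.le]
  exact Real.sqrt_le_sqrt (h i).2

/-- Density bounds and decay of all norms for solutions with globally positive density. -/
lemma Sol.exists_decay {a γ ν r R A : ℝ} (ha : 0 < a) (hγ : 0 < γ) (hν : 0 < ν) (hr : 0 < r)
    (hA : 0 ≤ A) :
    ∃ lo hi C α : ℝ, 0 < lo ∧ 0 < hi ∧ 0 < C ∧ 0 < α ∧ ∀ η w : ℝ → ℝ → ℝ,
      Sol a γ ν η w → Data r R A η w → ∀ t, 0 ≤ t → (∀ x, lo ≤ η t x ∧ η t x ≤ hi) ∧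
        √(HSq 4 fun x => η t x - 1) + √(HSq 5 (w t)) + (√(HSq 3 (Dt η t)) + √(HSq 3 (Dt w t)))
          + (√(HSq 1 (Dt (Dt η) t)) + √(HSq 1 (Dt (Dt w) t)))
        ≤ C * √(HSq 5 (fun x => η 0 x - 1) + HSq 5 (w 0)) * Real.exp (-α * t) := by
  obtain ⟨lo, hi, M, β, C, hlo, hlohi, hM, hβ, hC, h⟩ := exists_energy_decay (R := R) ha hγ hν hr hA
  obtain ⟨C1, hC1, h1⟩ := (Snapshot.dominated_density_sub_one
    (a := a) (γ := γ) (ν := ν) (hi := hi) hlo hM).exists_sqrt_le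
  obtain ⟨C2, hC2, h2⟩ := (Snapshot.dominated_velocity
    (a := a) (γ := γ) (ν := ν) (lo := lo) (hi := hi) (M := M)).exists_sqrt_le
  obtain ⟨C3, hC3, h3⟩ := (Snapshot.dominated_Dt_density
    (a := a) (γ := γ) (ν := ν) (hi := hi) hlo hM).exists_sqrt_le
  obtain ⟨C4, hC4, h4⟩ := (Snapshot.dominated_Dt_velocity
    (a := a) (γ := γ) (ν := ν) (hi := hi) hlo hM).exists_sqrt_le
  obtain ⟨C5, hC5, h5⟩ := (Snapshot.dominated_Dt_Dt_density
    (a := a) (γ := γ) (ν := ν) (hi := hi) hlo hM).exists_sqrt_le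
  obtain ⟨C6, hC6, h6⟩ := (Snapshot.dominated_Dt_Dt_velocity
    (a := a) (γ := γ) (ν := ν) (hi := hi) hlo hM).exists_sqrt_le
  refine ⟨lo, hi, (C1 + C2 + (C3 + C4) + (C5 + C6)) * √C, β / 2, hlo, hlo.trans_le hlohi,
    by positivity, by positivity, fun η w hs hd t ht => ?_⟩
  obtain ⟨hb, hS, hE4, hE5⟩ := h η w hs hd t ht
  refine ⟨hb, ?_⟩
  set A5 := HSq 5 (fun x => η 0 x - 1) + HSq 5 (w 0) with hA5
  have hA5 : 0 ≤ A5 := add_nonneg (HSq_nonneg _ _) (HSq_nonneg _ _)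
  let p : Snapshot a γ ν lo hi M := ⟨η, w, t, hs, ht, hS, hE4, hs.exists_density_eq_one hd ht⟩
  have hexp : √(Real.exp (-β * t)) = Real.exp (-(β / 2) * t) := by
    rw [Real.sqrt_eq_iff_mul_self_eq (Real.exp_pos _).le (Real.exp_pos _).le, ← Real.exp_add]
    ring_nf
  have hE : √p.E ≤ √C * √A5 * Real.exp (-(β / 2) * t) := by
    rw [← hexp, ← Real.sqrt_mul hC.le, ← Real.sqrt_mul (by positivity)]
    exact Real.sqrt_le_sqrt hE5
  calc _ ≤ C1 * √p.E + C2 * √p.E + (C3 * √p.E + C4 * √p.E) + (C5 * √p.E + C6 * √p.E) :=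
        add_le_add (add_le_add (add_le_add (h1 p) (h2 p)) (add_le_add (h3 p) (h4 p)))
          (add_le_add (h5 p) (h6 p))
    _ = (C1 + C2 + (C3 + C4) + (C5 + C6)) * √p.E := by ring
    _ ≤ (C1 + C2 + (C3 + C4) + (C5 + C6)) * (√C * √A5 * Real.exp (-(β / 2) * t)) :=
        mul_le_mul_of_nonneg_left hE (by positivity)
    _ = _ := by ring

/-! ### Extension of the density to negative times -/

lemma exists_time_cutoff {ε : ℝ} (hε : 0 < ε) : ∃ χ : ℝ → ℝ, ContDiff ℝ ∞ χ ∧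
    (∀ t, 0 ≤ t → χ t = t) ∧ ∀ t, -ε < χ t := by
  refine ⟨fun t => t * Real.smoothTransition ((t + ε / 2) / (ε / 2)), ?_, fun t ht => ?_,
    fun t => ?_⟩
  · exact contDiff_id.mul (Real.smoothTransition.contDiff.comp
      ((contDiff_id.add contDiff_const).div_const _))
  · have h : 1 ≤ (t + ε / 2) / (ε / 2) := by
      rw [le_div_iff₀ (by positivity)]; linarith
    simp only [Real.smoothTransition.one_of_one_le h, mul_one]
  · have h0 := Real.smoothTransition.nonneg ((t + ε / 2) / (ε / 2))
    have h1 := Real.smoothTransition.le_one ((t + ε / 2) / (ε / 2))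
    rcases le_total t (-(ε / 2)) with ht | ht
    · have h2 : Real.smoothTransition ((t + ε / 2) / (ε / 2)) = 0 :=
        Real.smoothTransition.zero_of_nonpos
          (div_nonpos_of_nonpos_of_nonneg (by linarith) (by positivity))
      simp only [h2, mul_zero]
      linarith
    · simp only
      nlinarith

lemma SmoothSP.exists_pos_of_pos {f : ℝ → ℝ → ℝ} (hf : SmoothSP f)
    (hpos : ∀ t x, 0 ≤ t → 0 < f t x) : ∃ ε : ℝ, 0 < ε ∧ ∀ t x, -ε < t → 0 < f t x := by
  have h : ∀ᶠ t in nhds (0:ℝ), ∀ x ∈ Set.Icc (0:ℝ) 1, 0 < f t x :=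
    isCompact_Icc.eventually_forall_of_forall_eventually fun x _ =>
      hf.smooth.continuous.continuousAt.eventually (lt_mem_nhds (hpos 0 x le_rfl))
  obtain ⟨ε, hε, hb⟩ := Metric.eventually_nhds_iff.1 h
  refine ⟨ε, hε, fun t x ht => ?_⟩
  rcases le_or_gt 0 t with h0 | h0
  · exact hpos t x h0
  · obtain ⟨y, hy, hxy⟩ := Function.Periodic.exists_mem_Ico₀ (hf.per t) one_pos x
    rw [hxy]
    refine hb ?_ y (Set.Ico_subset_Icc_self hy)
    rw [Real.dist_eq, sub_zero, abs_lt]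
    exact ⟨ht, h0.trans hε⟩

lemma SmoothSP.comp_time {f : ℝ → ℝ → ℝ} (hf : SmoothSP f) {χ : ℝ → ℝ} (hχ : ContDiff ℝ ∞ χ) :
    SmoothSP fun t => f (χ t) where
  smooth := hf.smooth.comp ((hχ.comp contDiff_fst).prodMk contDiff_snd)
  per t := hf.per (χ t)

lemma SmoothSP.Dt_Dt_congr {f g : ℝ → ℝ → ℝ} (hf : SmoothSP f) (hg : SmoothSP g)
    (h : ∀ t, 0 ≤ t → f t = g t) {t : ℝ} (ht : 0 ≤ t) : Dt (Dt f) t = Dt (Dt g) t :=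
  hf.dt.Dt_congr hg.dt (fun _ hs => hf.Dt_congr hg h hs) ht

/-- A solution can be modified at negative times so that its density is positive everywhere. -/
lemma exists_sol_eqOn {a γ ν : ℝ} {η w : ℝ → ℝ → ℝ} (hη : SmoothSP η) (hw : SmoothSP w)
    (hpos : ∀ t x, 0 ≤ t → 0 < η t x)
    (hmass : ∀ t x, 0 ≤ t → Dt η t x + deriv (fun y => η t y * w t y) x = 0)
    (hmom : ∀ t x, 0 ≤ t → η t x * (Dt w t x + w t x * deriv (w t) x)
      - ν * deriv (deriv (w t)) x + deriv (fun y => a * η t y ^ γ) x = 0) :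
    ∃ η' w' : ℝ → ℝ → ℝ, Sol a γ ν η' w' ∧ (∀ t, 0 ≤ t → η' t = η t) ∧
      ∀ t, 0 ≤ t → w' t = w t := by
  obtain ⟨ε, hε, hpos'⟩ := hη.exists_pos_of_pos hpos
  obtain ⟨χ, hχ, hχ0, hχε⟩ := exists_time_cutoff hε
  have eη : ∀ t, 0 ≤ t → η (χ t) = η t := fun t ht => by rw [hχ0 t ht]
  have ew : ∀ t, 0 ≤ t → w (χ t) = w t := fun t ht => by rw [hχ0 t ht]
  have sη := hη.comp_time hχ
  have sw := hw.comp_time hχ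
  refine ⟨fun t => η (χ t), fun t => w (χ t),
    ⟨sη, sw, fun t x => hpos' _ x (hχε t), fun t x ht => ?_, fun t x ht => ?_⟩, eη, ew⟩
  · simp only [sη.Dt_congr hη eη ht, eη t ht, ew t ht]
    exact hmass t x ht
  · simp only [sw.Dt_congr hw ew ht, eη t ht, ew t ht]
    exact hmom t x ht

end NSDecay

/-- **Uniform density bounds and exponential decay of higher order norms**
(Proposition `S2prop1`): there are `η̲, η̄, C, α > 0`, depending only on
`(a, γ, ν, ς̄₀, ς̲₀, Ā)`, such that every global smooth solution of the 1D
isentropic compressible Navier–Stokes system on `[0,∞) × 𝕋` with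
`ς̲₀ ≤ η₀ ≤ ς̄₀`, `∫_𝕋 η₀ = 1`, `∫_𝕋 η₀ w₀ = 0` and
`‖η₀-1‖²_{H⁴} + ‖w₀‖²_{H⁴} ≤ Ā` satisfies `η̲ ≤ η ≤ η̄` everywhere and, with
`A₅ = ‖η₀-1‖²_{H⁵} + ‖w₀‖²_{H⁵}`, for all `t ≥ 0`:
`‖(η-1)(t)‖_{H⁴} + ‖w(t)‖_{H⁵}
  + ∑_{i=1}^{2} (‖∂ₜ^i η(t)‖_{H^{5-2i}} + ‖∂ₜ^i w(t)‖_{H^{5-2i}})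
  ≤ C A₅^{1/2} e^{-α t}`. -/
theorem higher_order_decay (a γ ν ςlow ςbar Abar : ℝ)
    (ha : 0 < a) (hγ1 : 1 ≤ γ) (hγ2 : γ ≤ 2) (hν : 0 < ν)
    (hςlow : 0 < ςlow) (hςord : ςlow ≤ ςbar) (hAbar : 0 < Abar) :
    ∃ ηlow ηbar C α : ℝ, 0 < ηlow ∧ 0 < ηbar ∧ 0 < C ∧ 0 < α ∧
      ∀ η w : ℝ → ℝ → ℝ,
        ContDiff ℝ (⊤ : ℕ∞) (Function.uncurry η) →
        ContDiff ℝ (⊤ : ℕ∞) (Function.uncurry w) →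
        (∀ t x : ℝ, η t (x + 1) = η t x) →
        (∀ t x : ℝ, w t (x + 1) = w t x) →
        (∀ t x : ℝ, 0 ≤ t → 0 < η t x) →
        (∀ t x : ℝ, 0 ≤ t →
          deriv (fun s => η s x) t + deriv (fun y => η t y * w t y) x = 0) →
        (∀ t x : ℝ, 0 ≤ t →
          η t x * (deriv (fun s => w s x) t + w t x * deriv (w t) x)
            - ν * deriv (deriv (w t)) x + deriv (fun y => a * η t y ^ γ) x = 0) →
        (∀ x : ℝ, ςlow ≤ η 0 x) →
        (∀ x : ℝ, η 0 x ≤ ςbar) →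
        (∫ x in (0:ℝ)..1, η 0 x) = 1 →
        (∫ x in (0:ℝ)..1, η 0 x * w 0 x) = 0 →
        HSq 4 (fun x => η 0 x - 1) + HSq 4 (w 0) ≤ Abar →
        (∀ t x : ℝ, 0 ≤ t → ηlow ≤ η t x ∧ η t x ≤ ηbar) ∧
          ∀ t : ℝ, 0 ≤ t →
            Real.sqrt (HSq 4 (fun x => η t x - 1)) + Real.sqrt (HSq 5 (w t))
              + (Real.sqrt (HSq 3 (fun x => deriv (fun s => η s x) t))
                  + Real.sqrt (HSq 3 (fun x => deriv (fun s => w s x) t)))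
              + (Real.sqrt (HSq 1 (fun x => deriv^[2] (fun s => η s x) t))
                  + Real.sqrt (HSq 1 (fun x => deriv^[2] (fun s => w s x) t)))
            ≤ C * Real.sqrt (HSq 5 (fun x => η 0 x - 1) + HSq 5 (w 0))
                * Real.exp (-α * t) := by
  obtain ⟨lo, hi, C, α, hlo, hhi, hC, hα, h⟩ := NSDecay.Sol.exists_decay (R := ςbar) ha
    (by linarith : 0 < γ) hν hςlow hAbar.le
  refine ⟨lo, hi, C, α, hlo, hhi, hC, hα, fun η w hη hw pη pw hpos hmass hmom hl hu hm hp hb => ?_⟩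
  have sη : NSDecay.SmoothSP η := ⟨hη, pη⟩
  have sw : NSDecay.SmoothSP w := ⟨hw, pw⟩
  obtain ⟨η', w', hs, eη, ew⟩ := NSDecay.exists_sol_eqOn sη sw hpos hmass hmom
  have h0 := eη 0 le_rfl
  have h0' := ew 0 le_rfl
  have hd : NSDecay.Data ςlow ςbar Abar η' w' := by
    refine ⟨?_, ?_, ?_, ?_, ?_⟩ <;> simpa only [h0, h0']
  have e1 : ∀ t : ℝ, 0 ≤ t → NSDecay.Dt η' t = NSDecay.Dt η t := fun t ht => hs.hη.Dt_congr sη eη ht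
  have e2 : ∀ t : ℝ, 0 ≤ t → NSDecay.Dt w' t = NSDecay.Dt w t := fun t ht => hs.hw.Dt_congr sw ew ht
  refine ⟨fun t x ht => ?_, fun t ht => ?_⟩
  · rw [← eη t ht]
    exact (h η' w' hs hd t ht).1 x
  · have h1 := (h η' w' hs hd t ht).2
    rw [hs.hη.Dt_Dt_congr sη eη ht, hs.hw.Dt_Dt_congr sw ew ht, e1 t ht, e2 t ht, eη t ht,
      ew t ht, h0, h0'] at h1
    exact h1
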